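/- arXiv:2203.16461 — 2 statements merged into one kernel-verified Lean document; each statement's English description precedes it below -/
import Mathlib

section
/- Nakada's colored hook formula: Let λ be a pre-dominant integral weight for a finite crystallographic root system. Then, as an identity of rational functions, the sum over all integers r ≥ 0 and all λ-paths (β_1, β_2, …, β_r) of the product (1/β_1)·(1/(β_1+β_2))·…·(1/(β_1+β_2+⋯+β_r)) (the empty path r = 0 contributing 1) equals the product ∏_{β ∈ D(λ)} (1 + 1/β). -/
open scoped Classical BigOperators

/-- A bundled setting for a finite crystallographic root system together with its
Weyl group, its action on the rational span of the weight lattice, reflections,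
and the data of coefficients of roots in the basis of simple roots. -/
structure WeylSetting where
  /-- index set of the Dynkin diagram (simple roots) -/
  I : Type
  [fintypeI : Fintype I]
  [decEqI : DecidableEq I]
  /-- rational span of the weight lattice -/
  V : Type
  [acg : AddCommGroup V]
  [mod : Module ℚ V]
  /-- the Weyl group -/
  W : Type
  [grp : Group W]
  /-- the action of the Weyl group on weights -/
  act : W →* (V ≃ₗ[ℚ] V)
  /-- the simple roots -/
  simple : I → V
  /-- the (finite) set of roots -/
  roots : Finset V
  /-- `coroot β μ` is the pairing `⟨μ, β∨⟩` -/
  coroot : V → (V →ₗ[ℚ] ℚ)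
  /-- the reflection `s_β ∈ W` associated to a root `β` -/
  srefl : V → W
  /-- coefficients of a positive root in the basis of simple roots -/
  posCoeff : V → I → ℕ
  simple_mem : ∀ i, simple i ∈ roots
  simple_indep : LinearIndependent ℚ simple
  roots_neg : ∀ β ∈ roots, -β ∈ roots
  root_pos_or_neg : ∀ β ∈ roots,
    (∃ c : I → ℚ, (∀ i, 0 ≤ c i) ∧ β = ∑ i, c i • simple i) ∨
    (∃ c : I → ℚ, (∀ i, 0 ≤ c i) ∧ -β = ∑ i, c i • simple i)
  coroot_self : ∀ β ∈ roots, coroot β β = 2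
  crystallographic : ∀ β ∈ roots, ∀ γ ∈ roots, ∃ n : ℤ, coroot β γ = n
  posCoeff_spec : ∀ β ∈ roots,
    (∃ c : I → ℚ, (∀ i, 0 ≤ c i) ∧ β = ∑ i, c i • simple i) →
    β = ∑ i, (posCoeff β i : ℚ) • simple i
  srefl_apply : ∀ β ∈ roots, ∀ v : V, act (srefl β) v = v - coroot β v • β
  act_faithful : ∀ g : W, (∀ v : V, act g v = v) → g = 1
  roots_invariant : ∀ g : W, ∀ β ∈ roots, act g β ∈ roots
  coroot_equivariant : ∀ g : W, ∀ β ∈ roots, ∀ v : V,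
    coroot (act g β) (act g v) = coroot β v
  generated : ∀ g : W, ∃ l : List I, g = (l.map fun i => srefl (simple i)).prod

namespace WeylSetting

attribute [instance] fintypeI decEqI acg mod grp

variable (D : WeylSetting)

/-- the simple reflection attached to a node of the Dynkin diagram -/
def s (i : D.I) : D.W := D.srefl (D.simple i)

/-- the product `s_{i_1} ⋯ s_{i_r}` of the simple reflections listed in `l` -/
def wordProd (l : List D.I) : D.W := (l.map D.s).prod

/-- `β` is a positive root: a root which is a nonnegative combination of simple roots -/
def IsPosRoot (β : D.V) : Prop :=
  β ∈ D.roots ∧ ∃ c : D.I → ℚ, (∀ i, 0 ≤ c i) ∧ β = ∑ i, c i • D.simple i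

/-- the length of a Weyl group element -/
noncomputable def length (g : D.W) : ℕ :=
  sInf {n | ∃ l : List D.I, l.length = n ∧ D.wordProd l = g}

/-- `l` is a reduced word for `g` -/
def IsReduced (l : List D.I) (g : D.W) : Prop :=
  D.wordProd l = g ∧ l.length = D.length g

/-- the number of reduced words of `g` -/
noncomputable def RedCard (g : D.W) : ℕ := Nat.card {l : List D.I // D.IsReduced l g}

/-- the (strong) Bruhat order on the Weyl group -/
def bruhatLE : D.W → D.W → Prop :=
  Relation.ReflTransGen
    (fun a b => (∃ β, D.IsPosRoot β ∧ b = D.srefl β * a) ∧ D.length a < D.length b)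

/-- strict (strong) Bruhat order -/
def bruhatLT (a b : D.W) : Prop := D.bruhatLE a b ∧ a ≠ b

/-- the left weak Bruhat order: `a ≤_L b` iff `ℓ(b a⁻¹) + ℓ(a) = ℓ(b)` -/
def weakLE (a b : D.W) : Prop := D.length (b * a⁻¹) + D.length a = D.length b

/-- the height of a positive root: the sum of its coefficients in the simple roots -/
noncomputable def ht (β : D.V) : ℕ := ∑ i, D.posCoeff β i

/-- an integral weight: the pairings with all positive coroots are integers -/
def IsIntegral (lam : D.V) : Prop :=
  ∀ β, D.IsPosRoot β → ∃ n : ℤ, D.coroot β lam = n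

/-- a dominant integral weight -/
def IsDominant (lam : D.V) : Prop :=
  D.IsIntegral lam ∧ ∀ i, 0 ≤ D.coroot (D.simple i) lam

/-- a pre-dominant integral weight: `⟨λ, β∨⟩ ≥ -1` for all positive roots `β` -/
def IsPreDominant (lam : D.V) : Prop :=
  D.IsIntegral lam ∧ ∀ β, D.IsPosRoot β → -1 ≤ D.coroot β lam

/-- the diagram `D(λ) = {β ∈ R⁺ : ⟨λ, β∨⟩ = -1}` of a pre-dominant weight -/
noncomputable def diagram (lam : D.V) : Finset D.V :=
  D.roots.filter fun β => D.IsPosRoot β ∧ D.coroot β lam = -1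

/-- `IsWeightPath λ [β₁, …, β_r]` says that
`λ = λ₀ →β₁ λ₁ →β₂ ⋯ →β_r λ_r` is a `λ`-path, i.e. each `β_j` is a positive
root, `⟨λ_{j-1}, β_j∨⟩ = -1` and `λ_j = s_{β_j}(λ_{j-1})`. -/
def IsWeightPath : D.V → List D.V → Prop
  | _, [] => True
  | lam, β :: rest =>
      D.IsPosRoot β ∧ D.coroot β lam = -1 ∧
        IsWeightPath (D.act (D.srefl β) lam) rest

/-- the term `1/β₁ ⋅ 1/(β₁+β₂) ⋅ … ⋅ 1/(β₁+⋯+β_r)` attached to a path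
`(β₁, …, β_r)`, computed in a field `F` via a linear embedding `emb`. -/
noncomputable def pathTerm {F : Type} [Field F] [Algebra ℚ F]
    (emb : D.V →ₗ[ℚ] F) (l : List D.V) : F :=
  ∏ j ∈ Finset.range l.length, (emb ((l.take (j + 1)).sum))⁻¹

/-- `w` is a π-minuscule element (in the sense of Peterson). -/
def IsMinuscule (pi : D.V) (w : D.W) : Prop :=
  ∃ l : List D.I, D.IsReduced l w ∧
    ∀ k : Fin l.length,
      D.coroot (D.simple (l.get k)) (D.act (D.wordProd (l.drop (k.val + 1))) pi) = 1

/-- the stabilizer `W_π = Stab_W(π)` of a weight -/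
def stab (pi : D.V) : Subgroup D.W where
  carrier := {g | D.act g pi = pi}
  one_mem' := by simp
  mul_mem' := by
    intro a b ha hb
    simp only [Set.mem_setOf_eq] at *
    calc D.act (a * b) pi = D.act a (D.act b pi) := by rw [map_mul]; rfl
    _ = pi := by rw [hb, ha]
  inv_mem' := by
    intro a ha
    simp only [Set.mem_setOf_eq] at *
    calc D.act a⁻¹ pi = D.act a⁻¹ (D.act a pi) := by rw [ha]
    _ = D.act (a⁻¹ * a) pi := by rw [map_mul]; rfl
    _ = pi := by simp

/-- `u` is the minimal-length representative of its coset `uH` -/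
def IsMinRep (H : Subgroup D.W) (u : D.W) : Prop :=
  ∀ g : D.W, u⁻¹ * g ∈ H → D.length u ≤ D.length g

/-- `a` and `b` lie in the same coset of `H`, i.e. `aH = bH` -/
def SameCoset (H : Subgroup D.W) (a b : D.W) : Prop := a⁻¹ * b ∈ H

/-- `u →β w` in `W^P`: `β` is a positive root, `u, w` are minimal-length
representatives, `s_β w H = u H`, and `u < w` in Bruhat order -/
def Arrow (H : Subgroup D.W) (u w : D.W) (β : D.V) : Prop :=
  D.IsPosRoot β ∧ D.IsMinRep H u ∧ D.IsMinRep H w ∧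
    D.SameCoset H (D.srefl β * w) u ∧ D.bruhatLT u w

/-- `ArrowPath H w [β₁, …, β_r]` encodes a directed path
`x_r →β_r ⋯ → x_1 →β₁ x_0 = w` in the Bruhat graph on `W^P`. -/
def ArrowPath (H : Subgroup D.W) : D.W → List D.V → Prop
  | _, [] => True
  | w, β :: rest => ∃ u, D.Arrow H u w β ∧ ArrowPath H u rest

/-- directed paths as above whose vertices all lie above `v` in Bruhat order -/
def ArrowPathGE (H : Subgroup D.W) (v : D.W) : D.W → List D.V → Prop
  | _, [] => True
  | w, β :: rest => ∃ u, D.Arrow H u w β ∧ D.bruhatLE v u ∧ ArrowPathGE H v u rest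

/-- directed paths from `u` to `w`:
`u = x_r →β_r ⋯ → x_1 →β₁ x_0 = w` encoded by the list `[β₁, …, β_r]`. -/
def ArrowPathFromTo (H : Subgroup D.W) (u : D.W) : D.W → List D.V → Prop
  | w, [] => u = w
  | w, β :: rest => ∃ x, D.Arrow H x w β ∧ ArrowPathFromTo H u x rest

/-- `S(w) = {β ∈ R⁺ : s_β w < w}` -/
noncomputable def Sset (w : D.W) : Finset D.V :=
  D.roots.filter fun β => D.IsPosRoot β ∧ D.bruhatLT (D.srefl β * w) w

/-- `S(w/v) = {β ∈ R⁺ : v ≤ s_β w < w}` -/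
noncomputable def SsetSkew (v w : D.W) : Finset D.V :=
  D.roots.filter fun β =>
    D.IsPosRoot β ∧ D.bruhatLE v (D.srefl β * w) ∧ D.bruhatLT (D.srefl β * w) w

/-- an oriented edge `x → y` in the Bruhat graph of `G/P`: `x, y` are minimal
representatives, `xH < yH`, and `yH = x s_γ H` for some positive root `γ` -/
def GEdge (H : Subgroup D.W) (x y : D.W) : Prop :=
  D.IsMinRep H x ∧ D.IsMinRep H y ∧ D.bruhatLT x y ∧
    ∃ γ, D.IsPosRoot γ ∧ D.SameCoset H (x * D.srefl γ) y

/-- the (unique) positive root `γ` with `yH = x s_γ H` attached to an edge -/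
noncomputable def edgeRoot (H : Subgroup D.W) (x y : D.W) : D.V :=
  if h : ∃ γ, D.IsPosRoot γ ∧ D.SameCoset H (x * D.srefl γ) y then h.choose else 0

/-- `GChainTo H v t [x₁, …, x_r]` encodes a directed path
`v ≤ x_r → ⋯ → x_1 → x_0 = t` in the Bruhat graph of `G/P` -/
def GChainTo (H : Subgroup D.W) (v : D.W) : D.W → List D.W → Prop
  | _, [] => True
  | t, x :: rest => D.GEdge H x t ∧ D.bruhatLE v x ∧ GChainTo H v x rest

/-- the weighted term
`(m_Λ(x_r,x_{r-1})/W_Λ(x_r)) ⋯ (m_Λ(x_1,x_0)/W_Λ(x_1))` of a path in the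
`Λ`-Bruhat graph, computed in a field `F` via a linear embedding `emb`. -/
noncomputable def chainTerm {F : Type} [Field F] [Algebra ℚ F]
    (emb : D.V →ₗ[ℚ] F) (H : Subgroup D.W) (Lam : D.W → D.V) (w : D.W) :
    D.W → List D.W → F
  | _, [] => 1
  | t, x :: rest =>
      algebraMap ℚ F (D.coroot (D.edgeRoot H x t) (Lam x)) *
        (emb (D.act x (Lam x) - D.act w (Lam x)))⁻¹ *
        chainTerm emb H Lam w x rest

/-- the Bruhat order on cosets: `aH ≤ bH` -/
def cosetLE (H : Subgroup D.W) (a b : D.W) : Prop :=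
  ∃ x y, D.SameCoset H a x ∧ D.SameCoset H b y ∧ D.bruhatLE x y

/-- the (standard) parabolic subgroup generated by simple reflections in `J` -/
def parab (J : Set D.I) : Subgroup D.W := Subgroup.closure (D.s '' J)

/-- `X*(T)_P`: integral weights orthogonal to all coroots of `W_P`,
i.e. to `γ∨` for all positive roots `γ` in the span of the simple roots of `P` -/
def OrthWeightP (J : Set D.I) (lam : D.V) : Prop :=
  D.IsIntegral lam ∧
    ∀ γ, D.IsPosRoot γ → γ ∈ Submodule.span ℚ (D.simple '' J) → D.coroot γ lam = 0

/-- an admissible function `Λ : [v,w]^P → X*(T)_P` -/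
def Admissible (J : Set D.I) (v w : D.W) (Lam : D.W → D.V) : Prop :=
  (∀ x, D.IsMinRep (D.parab J) x → D.bruhatLE v x → D.bruhatLE x w →
      D.OrthWeightP J (Lam x)) ∧
  (∀ x, D.IsMinRep (D.parab J) x → D.bruhatLE v x → D.bruhatLE x w → x ≠ w →
      D.act x (Lam x) ≠ D.act w (Lam x))

/-- the subword of `l` with letters at the positions in `S`, in increasing order -/
def subwordF (l : List D.I) (S : Finset (Fin l.length)) : List D.I :=
  ((List.finRange l.length).filter fun j => j ∈ S).map l.get

/-- `β_j = s_{i_1} ⋯ s_{i_{j-1}}(α_{i_j})` attached to a reduced word `l` -/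
noncomputable def refRoot (l : List D.I) (j : Fin l.length) : D.V :=
  D.act (D.wordProd (l.take j.val)) (D.simple (l.get j))

/-- the Weyl group is simply laced: the Cartan pairing is symmetric -/
def SimplyLaced : Prop :=
  ∀ i j, D.coroot (D.simple i) (D.simple j) = D.coroot (D.simple j) (D.simple i)

/-- generating relation of the heap order of the word `l`:
`p_j < p_k` whenever `j < k` and `s_{i_j}`, `s_{i_k}` do not commute -/
def heapCovers (l : List D.I) (j k : Fin l.length) : Prop :=
  (j : ℕ) < (k : ℕ) ∧ D.s (l.get j) * D.s (l.get k) ≠ D.s (l.get k) * D.s (l.get j)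

/-- the heap order of the word `l`: the minimal partial order generated by
`heapCovers` -/
def heapLE (l : List D.I) : Fin l.length → Fin l.length → Prop :=
  Relation.ReflTransGen (D.heapCovers l)

/-- strict heap order -/
def heapLT (l : List D.I) (j k : Fin l.length) : Prop := D.heapLE l j k ∧ j ≠ k

/-- `F` is an order filter of the heap `H(w)` of the word `l` -/
def IsHeapFilter (l : List D.I) (F : Finset (Fin l.length)) : Prop :=
  ∀ j k, j ∈ F → D.heapLE l j k → k ∈ F

/-- `i` and `j` are joined by an edge of the Dynkin diagram -/
def adjDynkin (i j : D.I) : Prop := i ≠ j ∧ D.s i * D.s j ≠ D.s j * D.s i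

/-- an elementary excitation `A ▷ B` of subsets of the heap of the word `l` -/
def Excite (l : List D.I) (A B : Finset (Fin l.length)) : Prop :=
  ∃ p q, D.heapLT l p q ∧ l.get p = l.get q ∧ q ∈ A ∧ p ∈ B ∧
    A.erase q = B.erase p ∧
    (∀ z, D.heapLT l p z → D.heapLT l z q → l.get z ≠ l.get p) ∧
    ∀ u ∈ A, D.heapLE l p u → D.heapLE l u q → ¬ D.adjDynkin (l.get p) (l.get u)

/-- `A` is an excited diagram of `F` in the heap of the word `l`,
i.e. `A ∈ E_{H(w)}(F)` -/
def InExcited (l : List D.I) (F A : Finset (Fin l.length)) : Prop :=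
  Relation.ReflTransGen (D.Excite l) F A

end WeylSetting

namespace WeylSetting

variable (D : WeylSetting)

lemma nk_exists_fun (c : D.I → ℚ) : ∃ h : D.V →ₗ[ℚ] ℚ, ∀ i, h (D.simple i) = c i := by
  obtain ⟨g, hg⟩ := LinearMap.exists_extend
    ((Module.Basis.span D.simple_indep).constr ℚ c)
  refine ⟨g, fun i => ?_⟩
  have h1 := congrArg (fun f => f (Module.Basis.span D.simple_indep i)) hg
  simp only [LinearMap.comp_apply, Module.Basis.constr_basis, Submodule.subtype_apply] at h1
  rw [Module.Basis.span_apply] at h1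
  exact h1

/-- the height functional -/
noncomputable def nkH : D.V →ₗ[ℚ] ℚ := (D.nk_exists_fun fun _ => 1).choose

lemma nkH_simple (i : D.I) : D.nkH (D.simple i) = 1 := (D.nk_exists_fun fun _ => 1).choose_spec i

lemma nk_root_ne {β : D.V} (h : β ∈ D.roots) : β ≠ 0 := by
  rintro rfl
  have := D.coroot_self 0 h
  simp at this

lemma nkH_pos {β : D.V} (h : D.IsPosRoot β) : 0 < D.nkH β := by
  obtain ⟨hr, c, hc, rfl⟩ := h
  have e : D.nkH (∑ i, c i • D.simple i) = ∑ i, c i := by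
    simp [map_sum, nkH_simple]
  rw [e]
  rcases (Finset.sum_nonneg (fun i _ => hc i)).lt_or_eq with h | h
  · exact h
  · exfalso
    have h0 := (Finset.sum_eq_zero_iff_of_nonneg (fun i _ => hc i)).1 h.symm
    refine D.nk_root_ne hr (Finset.sum_eq_zero fun i hi => ?_)
    rw [h0 i hi, zero_smul]

lemma nk_pos_or {β : D.V} (h : β ∈ D.roots) : D.IsPosRoot β ∨ D.IsPosRoot (-β) := by
  rcases D.root_pos_or_neg β h with h1 | h1
  · exact Or.inl ⟨h, h1⟩
  · exact Or.inr ⟨D.roots_neg β h, h1⟩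

lemma nk_simple_pos (i : D.I) : D.IsPosRoot (D.simple i) :=
  ⟨D.simple_mem i, fun j => if j = i then 1 else 0, fun j => by dsimp only; split_ifs <;> norm_num, by simp⟩

lemma nk_refl_refl {β : D.V} (h : β ∈ D.roots) (v : D.V) :
    D.act (D.srefl β) (D.act (D.srefl β) v) = v := by
  rw [D.srefl_apply β h, D.srefl_apply β h, map_sub, map_smul, D.coroot_self β h, smul_eq_mul]
  module

lemma nk_coroot_refl {β γ : D.V} (h : β ∈ D.roots) (hγ : γ ∈ D.roots) (v : D.V) :
    D.coroot (D.act (D.srefl β) γ) v = D.coroot γ (D.act (D.srefl β) v) := by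
  have := D.coroot_equivariant (D.srefl β) γ hγ (D.act (D.srefl β) v)
  rwa [D.nk_refl_refl h] at this

lemma nk_refl_self {β : D.V} (h : β ∈ D.roots) : D.act (D.srefl β) β = -β := by
  rw [D.srefl_apply β h, D.coroot_self β h]; module

/-- the invariant form -/
noncomputable def nkB (u v : D.V) : ℚ := ∑ γ ∈ D.roots, D.coroot γ u * D.coroot γ v

lemma nkB_refl {β : D.V} (h : β ∈ D.roots) (u v : D.V) :
    D.nkB (D.act (D.srefl β) u) (D.act (D.srefl β) v) = D.nkB u v := by
  unfold nkB
  refine Finset.sum_nbij' (fun γ => D.act (D.srefl β) γ) (fun γ => D.act (D.srefl β) γ) ?_ ?_ ?_ ?_ ?_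
  · exact fun γ hγ => D.roots_invariant _ _ hγ
  · exact fun γ hγ => D.roots_invariant _ _ hγ
  · exact fun γ hγ => D.nk_refl_refl h γ
  · exact fun γ hγ => D.nk_refl_refl h γ
  · intro γ hγ
    rw [D.nk_coroot_refl h hγ, D.nk_coroot_refl h hγ]

lemma nkB_pos {β : D.V} (h : β ∈ D.roots) : 0 < D.nkB β β := by
  refine Finset.sum_pos' (fun γ _ => mul_self_nonneg _) ⟨β, h, ?_⟩
  rw [D.coroot_self β h]; norm_num

lemma nkB_comm (u v : D.V) : D.nkB u v = D.nkB v u := by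
  unfold nkB
  exact Finset.sum_congr rfl fun _ _ => mul_comm _ _

lemma nkB_sub (u v w : D.V) : D.nkB u (v - w) = D.nkB u v - D.nkB u w := by
  simp [nkB, mul_sub, Finset.sum_sub_distrib]

lemma nkB_smul (u v : D.V) (c : ℚ) : D.nkB u (c • v) = c * D.nkB u v := by
  simp only [nkB, map_smul, smul_eq_mul, Finset.mul_sum]
  exact Finset.sum_congr rfl fun _ _ => by ring

lemma nkB_sum (u : D.V) (c : D.I → ℚ) :
    D.nkB u (∑ i, c i • D.simple i) = ∑ i, c i * D.nkB u (D.simple i) := by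
  simp only [nkB, map_sum, map_smul, smul_eq_mul, Finset.mul_sum]
  rw [Finset.sum_comm]
  exact Finset.sum_congr rfl fun _ _ => Finset.sum_congr rfl fun _ _ => by ring

lemma nkB_neg (u v : D.V) : D.nkB (-u) v = -D.nkB u v := by
  simp [nkB]

lemma nkB_coroot {β : D.V} (h : β ∈ D.roots) (v : D.V) :
    2 * D.nkB β v = D.coroot β v * D.nkB β β := by
  have h1 := D.nkB_refl h β v
  rw [D.nk_refl_self h, D.srefl_apply β h, nkB_neg, nkB_sub, nkB_smul] at h1
  linarith

lemma nk_sign {β γ : D.V} (h : β ∈ D.roots) (hγ : γ ∈ D.roots) (hp : 0 < D.coroot β γ) :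
    0 < D.coroot γ β := by
  have h1 := D.nkB_coroot h γ
  have h2 := D.nkB_coroot hγ β
  rw [D.nkB_comm γ β, h1] at h2
  have h3 := mul_pos hp (D.nkB_pos h)
  rw [h2] at h3
  exact (pos_iff_pos_of_mul_pos h3).2 (D.nkB_pos hγ)

lemma nk_coroot_mul {β α : D.V} {c : ℚ} (h : β ∈ D.roots) (hα : α ∈ D.roots)
    (hc : β = c • α) (v : D.V) : c * D.coroot β v = D.coroot α v := by
  have hc0 : c ≠ 0 := by
    rintro rfl
    exact D.nk_root_ne h (by rw [hc, zero_smul])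
  have h1 := D.nkB_coroot h v
  have h2 := D.nkB_coroot hα v
  have e : ∀ w, D.nkB β w = c * D.nkB α w := fun w => by
    rw [D.nkB_comm, hc, nkB_smul, D.nkB_comm]
  rw [e, e, D.nkB_comm α β, e] at h1
  have h3 := D.nkB_pos hα
  have : c * D.nkB α α * (c * D.coroot β v - D.coroot α v) = 0 := by
    linear_combination c * h2 - h1
  rcases mul_eq_zero.1 this with h4 | h4
  · exact absurd h4 (mul_ne_zero hc0 h3.ne')
  · linarith

/-- if `s_β γ` is not positive then `⟨γ, β∨⟩ > 0`. -/
lemma nk_refl_pos {β γ : D.V} (h : D.IsPosRoot β) (hγ : D.IsPosRoot γ) :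
    D.IsPosRoot (D.act (D.srefl β) γ) ∨ 0 < D.coroot γ β := by
  rcases D.nk_pos_or (D.roots_invariant (D.srefl β) γ hγ.1) with h1 | h1
  · exact Or.inl h1
  · right
    apply D.nk_sign h.1 hγ.1
    have h2 := D.nkH_pos h1
    rw [D.srefl_apply β h.1] at h2
    simp only [map_neg, map_sub, map_smul, smul_eq_mul] at h2
    have h3 := D.nkH_pos h
    have h4 := D.nkH_pos hγ
    by_contra hn
    nlinarith

lemma nk_simple_refl (i : D.I) {β : D.V} (h : D.IsPosRoot β) :
    D.IsPosRoot (D.act (D.srefl (D.simple i)) β) ∨ ∃ c : ℚ, 0 < c ∧ β = c • D.simple i := by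
  rcases D.nk_pos_or (D.roots_invariant (D.srefl (D.simple i)) β h.1) with h1 | h1
  · exact Or.inl h1
  · right
    obtain ⟨c, hc, hβ⟩ := h.2
    obtain ⟨_, d, hd, hneg⟩ := h1
    have key : ∀ j, j ≠ i → c j = 0 := by
      intro j hj
      obtain ⟨ξ, hξ⟩ := D.nk_exists_fun (fun k => if k = j then 1 else 0)
      have h2 := congrArg ξ hneg
      have h5 := congrArg ξ hβ
      rw [D.srefl_apply _ (D.simple_mem i)] at h2
      simp [map_sum, hξ, hj.symm] at h2 h5
      have := hc j
      have := hd j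
      linarith
    have e : β = c i • D.simple i := by
      rw [hβ]
      exact Finset.sum_eq_single i (fun j _ hj => by rw [key j hj, zero_smul]) (by simp)
    refine ⟨c i, lt_of_le_of_ne (hc i) ?_, e⟩
    intro h0
    exact D.nk_root_ne h.1 (by rw [e, ← h0, zero_smul])

lemma nk_arrow {β μ : D.V} (h : D.IsPosRoot β) (hm : D.coroot β μ = -1) :
    D.act (D.srefl β) μ = μ + β := by
  rw [D.srefl_apply β h.1, hm]; module

lemma nk_predom_step {β μ : D.V} (h : D.IsPosRoot β) (hm : D.coroot β μ = -1)
    (hμ : D.IsPreDominant μ) : D.IsPreDominant (μ + β) := by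
  refine ⟨fun γ hγ => ?_, fun γ hγ => ?_⟩
  · obtain ⟨a, ha⟩ := hμ.1 γ hγ
    obtain ⟨b, hb⟩ := D.crystallographic γ hγ.1 β h.1
    exact ⟨a + b, by rw [map_add, ha, hb]; push_cast; rfl⟩
  · rcases D.nk_refl_pos h hγ with h1 | h1
    · have := hμ.2 _ h1
      rwa [D.nk_coroot_refl h.1 hγ.1, D.nk_arrow h hm] at this
    · have := hμ.2 γ hγ
      rw [map_add]; linarith

lemma nk_mem_diagram {β μ : D.V} : β ∈ D.diagram μ ↔ D.IsPosRoot β ∧ D.coroot β μ = -1 := by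
  unfold diagram
  rw [Finset.mem_filter]
  exact ⟨fun h => h.2, fun h => ⟨h.1.1, h⟩⟩

/-- predominant: negative pairing equals -1 -/
lemma nk_neg_one {β μ : D.V} (h : D.IsPosRoot β) (hμ : D.IsPreDominant μ)
    (hn : D.coroot β μ < 0) : D.coroot β μ = -1 := by
  obtain ⟨n, hn'⟩ := hμ.1 β h
  have h2 := hμ.2 β h
  rw [hn'] at hn h2 ⊢
  have a : n < 0 := by exact_mod_cast hn
  have b : -1 ≤ n := by exact_mod_cast h2
  have : n = -1 := by omega
  rw [this]; norm_num

lemma nk_card_lt {β μ : D.V} (h : D.IsPosRoot β) (hm : D.coroot β μ = -1)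
    (hμ : D.IsPreDominant μ) : (D.diagram (μ + β)).card < (D.diagram μ).card := by
  set S := D.act (D.srefl β) with hS
  have hβm : β ∈ D.diagram μ := D.nk_mem_diagram.2 ⟨h, hm⟩
  have hlt : ((D.diagram μ).erase β).card < (D.diagram μ).card := Finset.card_erase_lt_of_mem hβm
  refine lt_of_le_of_lt ?_ hlt
  refine Finset.card_le_card_of_injOn (fun γ => if D.IsPosRoot (S γ) then S γ else γ) ?_ ?_
  · intro γ hγ
    have hγ := D.nk_mem_diagram.1 (Finset.mem_coe.1 hγ)
    simp only [Finset.coe_erase, Set.mem_sdiff, Finset.mem_coe, Set.mem_singleton_iff]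
    split_ifs with hp
    · refine ⟨D.nk_mem_diagram.2 ⟨hp, ?_⟩, ?_⟩
      · rw [D.nk_coroot_refl h.1 hγ.1.1, D.nk_arrow h hm]; exact hγ.2
      · intro he
        have e2 : γ = -β := by
          rw [← D.nk_refl_refl h.1 γ, ← hS, he, hS, D.nk_refl_self h.1]
        have h1 := D.nkH_pos hγ.1
        have h2 := D.nkH_pos h
        rw [e2, map_neg] at h1
        linarith
    · have hc := (D.nk_refl_pos h hγ.1).resolve_left hp
      have hγ2 := hγ.2
      rw [map_add] at hγ2
      have h3 := hμ.2 γ hγ.1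
      exfalso; linarith
  · intro γ hγ δ hδ he
    have hγ := D.nk_mem_diagram.1 (Finset.mem_coe.1 hγ)
    have hδ := D.nk_mem_diagram.1 (Finset.mem_coe.1 hδ)
    have key : ∀ γ, D.IsPosRoot γ → D.coroot γ (μ + β) = -1 → D.IsPosRoot (S γ) := by
      intro γ h1 h2
      refine (D.nk_refl_pos h h1).resolve_right fun hc => ?_
      rw [map_add] at h2
      have h3 := hμ.2 γ h1
      linarith
    simp only [key γ hγ.1 hγ.2, key δ hδ.1 hδ.2, if_true] at he
    exact S.injective he

/-- reachability along arrows -/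
def NkReach : D.V → D.V → Prop :=
  Relation.ReflTransGen (fun μ ν => ∃ β, D.IsPosRoot β ∧ D.coroot β μ = -1 ∧ ν = μ + β)

lemma nk_reach_predom {lam μ : D.V} (h : D.IsPreDominant lam) (hr : D.NkReach lam μ) :
    D.IsPreDominant μ := by
  induction hr with
  | refl => exact h
  | tail _ hs ih =>
    obtain ⟨β, h1, h2, rfl⟩ := hs
    exact D.nk_predom_step h1 h2 ih

lemma nk_reach_H {lam μ : D.V} (hr : D.NkReach lam μ) : D.nkH lam ≤ D.nkH μ := by
  induction hr with
  | refl => exact le_rfl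
  | tail _ hs ih =>
    obtain ⟨β, h1, h2, rfl⟩ := hs
    have := D.nkH_pos h1
    rw [map_add]; linarith

lemma nk_mult_simple {i : D.I} {β μ : D.V} {c : ℚ} (h : D.IsPosRoot β) (hc : 0 < c)
    (hβ : β = c • D.simple i) (hμ : D.IsPreDominant μ) (hm : D.coroot β μ = -1) :
    β = D.simple i := by
  have h1 := D.nk_coroot_mul h.1 (D.simple_mem i) hβ μ
  rw [hm] at h1
  have h2 := D.nk_neg_one (D.nk_simple_pos i) hμ (by linarith)
  have : c = 1 := by linarith
  rw [hβ, this, one_smul]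

lemma nk_reach_simple {i : D.I} {lam μ : D.V} (h : D.IsPreDominant lam)
    (hi : D.coroot (D.simple i) lam = -1) (hr : D.NkReach lam μ) :
    D.NkReach lam (D.act (D.srefl (D.simple i)) μ) := by
  induction hr with
  | refl =>
    rw [D.nk_arrow (D.nk_simple_pos i) hi]
    exact Relation.ReflTransGen.single ⟨_, D.nk_simple_pos i, hi, rfl⟩
  | @tail ν ρ hν hs ih =>
    obtain ⟨β, h1, h2, rfl⟩ := hs
    rcases D.nk_simple_refl i h1 with h3 | ⟨c, hc, h3⟩
    · refine ih.tail ⟨_, h3, ?_, map_add _ _ _⟩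
      rw [D.coroot_equivariant _ _ h1.1, h2]
    · have := D.nk_mult_simple h1 hc h3 (D.nk_reach_predom h hν) h2
      subst this
      rw [← D.nk_arrow h1 h2, D.nk_refl_refl h1.1]
      exact hν

lemma nk_reach_abs {i : D.I} {lam μ : D.V} (h : D.IsPreDominant lam)
    (hi : D.coroot (D.simple i) lam = -1) (hr : D.NkReach lam μ) :
    D.coroot (D.simple i) μ = -1 ∨ D.coroot (D.simple i) μ = 0 ∨ D.coroot (D.simple i) μ = 1 := by
  have hp := D.nk_simple_pos i
  have a := D.nk_reach_predom h hr
  have b := (D.nk_reach_predom h (D.nk_reach_simple h hi hr)).2 _ hp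
  rw [← D.nk_coroot_refl hp.1 hp.1, D.nk_refl_self hp.1] at b
  have e := D.nk_coroot_mul (D.roots_neg _ hp.1) hp.1 (c := -1) (by module) μ
  obtain ⟨n, hn⟩ := a.1 _ hp
  have c := a.2 _ hp
  rw [hn] at c e ⊢
  have h1 : (n : ℚ) ≤ 1 := by linarith
  have h1' : n ≤ 1 := by exact_mod_cast h1
  have h2 : -1 ≤ n := by exact_mod_cast c
  have : n = -1 ∨ n = 0 ∨ n = 1 := by omega
  rcases this with rfl | rfl | rfl <;> simp

lemma nk_dominant {lam : D.V} (h : ∀ i, 0 ≤ D.coroot (D.simple i) lam) {β : D.V}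
    (hβ : D.IsPosRoot β) : 0 ≤ D.coroot β lam := by
  have h1 := D.nkB_coroot hβ.1 lam
  obtain ⟨c, hc, e⟩ := hβ.2
  have h2 : 0 ≤ D.nkB β lam := by
    rw [D.nkB_comm]
    nth_rewrite 1 [e]
    rw [nkB_sum]
    refine Finset.sum_nonneg fun i _ => mul_nonneg (hc i) ?_
    rw [D.nkB_comm]
    have h3 := D.nkB_coroot (D.simple_mem i) lam
    have := mul_nonneg (h i) (D.nkB_pos (D.simple_mem i)).le
    linarith
  by_contra hn
  have := mul_neg_of_neg_of_pos (not_le.1 hn) (D.nkB_pos hβ.1)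
  linarith

lemma nk_diagram_simple {i : D.I} {lam : D.V} (h : D.IsPreDominant lam)
    (hi : D.coroot (D.simple i) lam = -1) :
    D.diagram lam = insert (D.simple i)
      ((D.diagram (lam + D.simple i)).image (D.act (D.srefl (D.simple i)))) ∧
    D.simple i ∉ (D.diagram (lam + D.simple i)).image (D.act (D.srefl (D.simple i))) := by
  have hp := D.nk_simple_pos i
  have harr := D.nk_arrow hp hi
  have h' := D.nk_predom_step hp hi h
  have hone : D.coroot (D.simple i) (lam + D.simple i) = 1 := by
    rw [map_add, hi, D.coroot_self _ hp.1]; norm_num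
  constructor
  · ext β
    rw [Finset.mem_insert, Finset.mem_image, D.nk_mem_diagram]
    constructor
    · rintro ⟨h1, h2⟩
      rcases D.nk_simple_refl i h1 with h3 | ⟨c, hc, h3⟩
      · right
        refine ⟨_, D.nk_mem_diagram.2 ⟨h3, ?_⟩, D.nk_refl_refl hp.1 β⟩
        rw [← harr, D.coroot_equivariant _ _ h1.1, h2]
      · exact Or.inl (D.nk_mult_simple h1 hc h3 h h2)
    · rintro (rfl | ⟨γ, hγ, rfl⟩)
      · exact ⟨hp, hi⟩
      · obtain ⟨h1, h2⟩ := D.nk_mem_diagram.1 hγ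
        refine ⟨?_, ?_⟩
        · rcases D.nk_simple_refl i h1 with h3 | ⟨c, hc, h3⟩
          · exact h3
          · have := D.nk_mult_simple h1 hc h3 h' h2
            rw [this, hone] at h2
            norm_num at h2
        · rw [D.nk_coroot_refl hp.1 h1.1, harr, h2]
  · rw [Finset.mem_image]
    rintro ⟨γ, hγ, e⟩
    obtain ⟨h1, h2⟩ := D.nk_mem_diagram.1 hγ
    have : γ = -D.simple i := by
      rw [← D.nk_refl_refl hp.1 γ, e, D.nk_refl_self hp.1]
    have h3 := D.nkH_pos h1
    rw [this, map_neg, nkH_simple] at h3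
    linarith

/-- labels of the arrows into `μ` -/
noncomputable def nkE (μ : D.V) : Finset D.V :=
  D.roots.filter fun β => D.IsPosRoot β ∧ D.coroot β μ = 1

lemma nk_mem_E {β μ : D.V} : β ∈ D.nkE μ ↔ D.IsPosRoot β ∧ D.coroot β μ = 1 := by
  unfold nkE
  rw [Finset.mem_filter]
  exact ⟨fun h => h.2, fun h => ⟨h.1.1, h⟩⟩

lemma nk_bad {i : D.I} {β μ : D.V} (h : β ∈ D.nkE μ)
    (hb : ¬ D.IsPosRoot (D.act (D.srefl (D.simple i)) β)) :
    0 < D.coroot (D.simple i) μ ∧ β = D.coroot (D.simple i) μ • D.simple i := by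
  obtain ⟨h1, h2⟩ := D.nk_mem_E.1 h
  obtain ⟨c, hc, e⟩ := (D.nk_simple_refl i h1).resolve_left hb
  have h3 := D.nk_coroot_mul h1.1 (D.simple_mem i) e μ
  rw [h2, mul_one] at h3
  rw [← h3]
  exact ⟨hc, e⟩

lemma nk_bad_one {i : D.I} {μ : D.V} (hm : D.coroot (D.simple i) μ = 1) :
    (D.nkE μ).filter (fun β => ¬ D.IsPosRoot (D.act (D.srefl (D.simple i)) β))
      = {D.simple i} := by
  have hp := D.nk_simple_pos i
  ext β
  rw [Finset.mem_filter, Finset.mem_singleton]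
  constructor
  · rintro ⟨h1, h2⟩
    have := (D.nk_bad h1 h2).2
    rwa [hm, one_smul] at this
  · rintro rfl
    refine ⟨D.nk_mem_E.2 ⟨hp, hm⟩, fun h => ?_⟩
    have := D.nkH_pos h
    rw [D.nk_refl_self hp.1, map_neg, nkH_simple] at this
    linarith

lemma nk_bad_none {i : D.I} {μ : D.V} (hm : D.coroot (D.simple i) μ ≤ 0) :
    (D.nkE μ).filter (fun β => ¬ D.IsPosRoot (D.act (D.srefl (D.simple i)) β)) = ∅ := by
  refine Finset.filter_eq_empty_iff.2 fun β h1 h2 => ?_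
  have := (D.nk_bad h1 h2).1
  linarith

lemma nk_coroot_simple_refl (i : D.I) (μ : D.V) :
    D.coroot (D.simple i) (D.act (D.srefl (D.simple i)) μ) = - D.coroot (D.simple i) μ := by
  rw [D.srefl_apply _ (D.simple_mem i), map_sub, map_smul, D.coroot_self _ (D.simple_mem i),
    smul_eq_mul]
  ring

lemma nk_star {F : Type} [Field F] [Algebra ℚ F] (i : D.I) (μ : D.V) (g : D.V → F)
    (hg : g μ ≠ 0 → D.coroot (D.simple i) μ = -1 ∨ D.coroot (D.simple i) μ = 0 ∨
      D.coroot (D.simple i) μ = 1) :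
    (∑ β ∈ D.nkE (D.act (D.srefl (D.simple i)) μ), g (D.act (D.srefl (D.simple i)) μ - β))
      + algebraMap ℚ F (D.coroot (D.simple i) μ) * g μ
    = ∑ β ∈ D.nkE μ, g (D.act (D.srefl (D.simple i)) (μ - β)) := by
  have hp := D.nk_simple_pos i
  set S := D.act (D.srefl (D.simple i)) with hS
  have hSS : ∀ v, S (S v) = v := D.nk_refl_refl hp.1
  set m := D.coroot (D.simple i) μ with hm
  have hSμ : S μ = μ - m • D.simple i := D.srefl_apply _ hp.1 μ
  have hmS : D.coroot (D.simple i) (S μ) = -m := D.nk_coroot_simple_refl i μ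
  have hSi : S (D.simple i) = - D.simple i := D.nk_refl_self hp.1
  rw [← Finset.sum_filter_add_sum_filter_not (D.nkE (S μ)) (fun β => D.IsPosRoot (S β)),
    ← Finset.sum_filter_add_sum_filter_not (D.nkE μ) (fun β => D.IsPosRoot (S β))]
  have hgood : ∑ β ∈ (D.nkE (S μ)).filter (fun β => D.IsPosRoot (S β)), g (S μ - β)
      = ∑ β ∈ (D.nkE μ).filter (fun β => D.IsPosRoot (S β)), g (S (μ - β)) := by
    refine Finset.sum_nbij' (fun β => S β) (fun β => S β) ?_ ?_ ?_ ?_ ?_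
    · intro β hβ
      obtain ⟨h1, h2⟩ := Finset.mem_filter.1 hβ
      obtain ⟨h3, h4⟩ := D.nk_mem_E.1 h1
      refine Finset.mem_filter.2 ⟨D.nk_mem_E.2 ⟨h2, ?_⟩, by rw [hSS]; exact h3⟩
      rw [hS, D.nk_coroot_refl hp.1 h3.1]; exact h4
    · intro β hβ
      obtain ⟨h1, h2⟩ := Finset.mem_filter.1 hβ
      obtain ⟨h3, h4⟩ := D.nk_mem_E.1 h1
      refine Finset.mem_filter.2 ⟨D.nk_mem_E.2 ⟨h2, ?_⟩, by rw [hSS]; exact h3⟩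
      rw [hS, D.nk_coroot_refl hp.1 h3.1, ← hS, hSS]; exact h4
    · exact fun β _ => hSS β
    · exact fun β _ => hSS β
    · intro β _
      rw [map_sub, hSS]
  rw [hgood, add_assoc]
  congr 1
  by_cases h0 : g μ = 0
  · rw [h0, mul_zero, add_zero, Finset.sum_eq_zero, Finset.sum_eq_zero]
    · intro β hβ
      obtain ⟨h1, h2⟩ := Finset.mem_filter.1 hβ
      have := (D.nk_bad h1 h2).2
      rw [← hm] at this
      rw [this, map_sub, map_smul, hSi, hSμ, ← h0]
      congr 1
      module
    · intro β hβ
      obtain ⟨h1, h2⟩ := Finset.mem_filter.1 hβ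
      have := (D.nk_bad h1 h2).2
      rw [hmS] at this
      rw [this, hSμ, ← h0]
      congr 1
      module
  · rcases hg h0 with h | h | h
    · have hμ0 : D.coroot (D.simple i) μ ≤ 0 := by rw [← hm, h]; norm_num
      have hμ1 : D.coroot (D.simple i) (S μ) = 1 := by rw [hmS, h]; norm_num
      rw [D.nk_bad_none hμ0, D.nk_bad_one hμ1, Finset.sum_singleton, Finset.sum_empty, hSμ, h,
        show μ - (-1 : ℚ) • D.simple i - D.simple i = μ by module]
      simp
    · have hμ0 : D.coroot (D.simple i) μ ≤ 0 := by rw [← hm, h]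
      have hμ1 : D.coroot (D.simple i) (S μ) ≤ 0 := by rw [hmS, h]; norm_num
      rw [D.nk_bad_none hμ0, D.nk_bad_none hμ1, h]
      simp
    · have hμ0 : D.coroot (D.simple i) μ = 1 := by rw [← hm, h]
      have hμ1 : D.coroot (D.simple i) (S μ) ≤ 0 := by rw [hmS, h]; norm_num
      rw [D.nk_bad_one hμ0, D.nk_bad_none hμ1, Finset.sum_singleton, Finset.sum_empty, map_sub,
        hSi, hSμ, h, show μ - (1 : ℚ) • D.simple i - -D.simple i = μ by module]
      simp

lemma nk_exists_g {F : Type} [Field F] [Algebra ℚ F] (n : ℕ) : ∀ (lam : D.V),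
    D.IsPreDominant lam → (D.diagram lam).card = n →
    ∀ e : D.V →ₗ[ℚ] F, Function.Injective e →
    ∃ g : D.V → F, (Function.support g).Finite ∧ (∀ μ, g μ ≠ 0 → D.NkReach lam μ) ∧ g lam = 1 ∧
      (∀ μ, e (μ - lam) * g μ = ∑ β ∈ D.nkE μ, g (μ - β)) ∧
      ∑ᶠ μ, g μ = ∏ β ∈ D.diagram lam, (1 + (e β)⁻¹) := by
  induction n using Nat.strong_induction_on with
  | _ n ih =>
  intro lam hlam hcard e he
  by_cases hex : ∃ i, D.coroot (D.simple i) lam < 0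
  · obtain ⟨i, hi⟩ := hex
    have hp := D.nk_simple_pos i
    replace hi := D.nk_neg_one hp hlam hi
    set S := D.act (D.srefl (D.simple i)) with hS
    have hSS : ∀ v, S (S v) = v := D.nk_refl_refl hp.1
    have harr : S lam = lam + D.simple i := D.nk_arrow hp hi
    have hlam' := D.nk_predom_step hp hi hlam
    have hstep : D.NkReach lam (lam + D.simple i) :=
      Relation.ReflTransGen.single ⟨_, hp, hi, rfl⟩
    obtain ⟨g, hfin, hreach, hone, hrec, hsum⟩ := ih _ (hcard ▸ D.nk_card_lt hp hi hlam)
      (lam + D.simple i) hlam' rfl (e.comp S.toLinearMap) (he.comp S.injective)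
    have ha : e (D.simple i) ≠ 0 := fun h =>
      D.nk_root_ne hp.1 (he (by rw [h, map_zero]))
    have hfin' : (Function.support fun μ => g (S μ)).Finite :=
      hfin.preimage S.injective.injOn
    have hfin'' : (Function.support fun μ => g μ * (e (D.simple i))⁻¹).Finite :=
      hfin.subset fun μ h => by
        rw [Function.mem_support] at h ⊢
        exact left_ne_zero_of_mul h
    refine ⟨fun μ => g (S μ) + g μ * (e (D.simple i))⁻¹, ?_, ?_, ?_, ?_, ?_⟩
    · exact (hfin'.union hfin'').subset (Function.support_add _ _)
    · intro μ hμ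
      by_cases h : g μ = 0
      · have h2 : g (S μ) ≠ 0 := by
          intro h2; apply hμ; simp [h, h2]
        have := D.nk_reach_simple hlam hi (hstep.trans (hreach _ h2))
        rwa [← hS, hSS] at this
      · exact hstep.trans (hreach _ h)
    · have : g lam = 0 := by
        by_contra h
        have := D.nk_reach_H (hreach _ h)
        rw [map_add, nkH_simple] at this
        linarith
      simp only [harr, hone, this]; simp
    · intro μ
      have hstar := D.nk_star (F := F) i μ g
        (fun h => D.nk_reach_abs hlam hi (hstep.trans (hreach _ h)))
      rw [← hS] at hstar
      have r1 := hrec (S μ)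
      have r2 := hrec μ
      simp only [LinearMap.comp_apply, LinearEquiv.coe_coe, map_sub, ← harr, hSS] at r1 r2
      have hSμ : S μ = μ - D.coroot (D.simple i) μ • D.simple i := D.srefl_apply _ hp.1 μ
      have r3 : e (S μ) = e μ - algebraMap ℚ F (D.coroot (D.simple i) μ) * e (D.simple i) := by
        rw [hSμ, map_sub, map_smul, Algebra.smul_def]
      rw [Finset.sum_add_distrib, ← Finset.sum_mul, ← hstar, ← r2, ← r1, r3, map_sub]
      field_simp
      ring
    · rw [finsum_add_distrib hfin' hfin'', ← finsum_mul,
        show ∑ᶠ μ, g (S μ) = ∑ᶠ μ, g μ from finsum_comp_equiv S.toEquiv (f := g)]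
      obtain ⟨hd, hnot⟩ := D.nk_diagram_simple hlam hi
      rw [hd, Finset.prod_insert hnot, Finset.prod_image (fun _ _ _ _ h => S.injective h), hsum]
      simp only [LinearMap.comp_apply, LinearEquiv.coe_coe, ← hS]
      ring
  · push Not at hex
    have hdom := fun β hβ => D.nk_dominant hex (β := β) hβ
    have hempty : D.diagram lam = ∅ := by
      refine Finset.eq_empty_of_forall_notMem fun β hβ => ?_
      obtain ⟨h1, h2⟩ := D.nk_mem_diagram.1 hβ
      have := hdom β h1
      linarith
    refine ⟨Pi.single lam 1, ?_, ?_, ?_, ?_, ?_⟩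
    · exact (Set.finite_singleton lam).subset Pi.support_single_subset
    · intro μ hμ
      by_cases h : μ = lam
      · rw [h]; exact Relation.ReflTransGen.refl
      · exact absurd (Pi.single_eq_of_ne h _) hμ
    · simp
    · intro μ
      rw [Finset.sum_eq_zero]
      · by_cases h : μ = lam
        · simp [h]
        · rw [Pi.single_eq_of_ne h, mul_zero]
      · intro β hβ
        obtain ⟨h1, h2⟩ := D.nk_mem_E.1 hβ
        refine Pi.single_eq_of_ne (fun h => ?_) _
        have := hdom β h1
        rw [← h, map_sub, h2, D.coroot_self β h1.1] at this
        norm_num at this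
    · rw [hempty, finsum_eq_single _ lam (fun μ h => Pi.single_eq_of_ne h _)]
      simp

/-- shifted path term -/
noncomputable def nkT {F : Type} [Field F] [Algebra ℚ F]
    (e : D.V →ₗ[ℚ] F) (c : D.V) (l : List D.V) : F :=
  ∏ j ∈ Finset.range l.length, (e (c + (l.take (j + 1)).sum))⁻¹

lemma nkT_cons {F : Type} [Field F] [Algebra ℚ F]
    (e : D.V →ₗ[ℚ] F) (c β : D.V) (l : List D.V) :
    D.nkT e c (β :: l) = (e (c + β))⁻¹ * D.nkT e (c + β) l := by
  unfold nkT
  rw [List.length_cons, Finset.prod_range_succ', mul_comm]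
  simp [add_assoc]

lemma nk_paths_eq (μ : D.V) : {l | D.IsWeightPath μ l} =
    insert [] (⋃ β ∈ (D.diagram μ : Set D.V),
      (fun l => β :: l) '' {l | D.IsWeightPath (μ + β) l}) := by
  ext l
  cases l with
  | nil => simp [IsWeightPath]
  | cons β l =>
    simp only [Set.mem_setOf_eq, IsWeightPath, Set.mem_insert_iff, reduceCtorEq, false_or,
      Set.mem_iUnion, Set.mem_image, List.cons.injEq, Finset.mem_coe, D.nk_mem_diagram]
    constructor
    · rintro ⟨h1, h2, h3⟩
      rw [D.nk_arrow h1 h2] at h3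
      exact ⟨β, ⟨h1, h2⟩, l, h3, rfl, rfl⟩
    · rintro ⟨γ, ⟨h1, h2⟩, l', h3, rfl, rfl⟩
      refine ⟨h1, h2, ?_⟩
      rwa [D.nk_arrow h1 h2]

lemma nk_paths_finite (n : ℕ) : ∀ μ, D.IsPreDominant μ → (D.diagram μ).card = n →
    {l | D.IsWeightPath μ l}.Finite := by
  induction n using Nat.strong_induction_on with
  | _ n ih =>
  intro μ hμ hn
  rw [D.nk_paths_eq]
  refine Set.Finite.insert _ (Set.Finite.biUnion (Finset.finite_toSet _) fun β hβ => ?_)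
  obtain ⟨h1, h2⟩ := D.nk_mem_diagram.1 (Finset.mem_coe.1 hβ)
  exact (ih _ (hn ▸ D.nk_card_lt h1 h2 hμ) _ (D.nk_predom_step h1 h2 hμ) rfl).image _

/-- shifted sum over all paths -/
noncomputable def nkPhi {F : Type} [Field F] [Algebra ℚ F]
    (e : D.V →ₗ[ℚ] F) (μ c : D.V) : F := ∑ᶠ l ∈ {l | D.IsWeightPath μ l}, D.nkT e c l

lemma nkPhi_rec {F : Type} [Field F] [Algebra ℚ F]
    (e : D.V →ₗ[ℚ] F) (μ c : D.V) (hμ : D.IsPreDominant μ) :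
    D.nkPhi e μ c = 1 + ∑ β ∈ D.diagram μ, (e (c + β))⁻¹ * D.nkPhi e (μ + β) (c + β) := by
  have hfin : ∀ β ∈ (D.diagram μ : Set D.V),
      ((fun l => β :: l) '' {l | D.IsWeightPath (μ + β) l}).Finite := by
    intro β hβ
    obtain ⟨h1, h2⟩ := D.nk_mem_diagram.1 (Finset.mem_coe.1 hβ)
    exact (D.nk_paths_finite _ _ (D.nk_predom_step h1 h2 hμ) rfl).image _
  unfold nkPhi
  rw [D.nk_paths_eq, finsum_mem_insert, finsum_mem_biUnion, finsum_mem_coe_finset]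
  · have hnil : D.nkT e c [] = 1 := by simp [nkT]
    rw [hnil]
    refine congrArg (fun x => 1 + x) (Finset.sum_congr rfl fun β _ => ?_)
    · rw [finsum_mem_image (fun _ _ _ _ h => (List.cons.inj h).2), mul_finsum_mem]
      exact finsum_congr fun l => finsum_congr fun _ => D.nkT_cons e c β l
  · intro β _ γ _ hne
    refine Set.disjoint_left.2 ?_
    rintro _ ⟨l, _, rfl⟩ ⟨l', _, h⟩
    exact hne (List.cons.inj h).1.symm
  · exact Finset.finite_toSet _
  · exact hfin
  · simp
  · exact Set.Finite.biUnion (Finset.finite_toSet _) hfin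

lemma nk_duality {F : Type} [Field F] [Algebra ℚ F] (lam : D.V) (hlam : D.IsPreDominant lam)
    (e : D.V →ₗ[ℚ] F) (he : Function.Injective e) (g : D.V → F)
    (hfin : (Function.support g).Finite) (hreach : ∀ μ, g μ ≠ 0 → D.NkReach lam μ)
    (hone : g lam = 1) (hrec : ∀ μ, e (μ - lam) * g μ = ∑ β ∈ D.nkE μ, g (μ - β)) :
    ∑ᶠ μ, g μ = D.nkPhi e lam 0 := by
  set f : D.V → F := fun μ => D.nkPhi e μ (μ - lam) with hf
  -- the arrow term
  set t : D.V → D.V → F := fun μ β =>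
    if D.IsPosRoot β ∧ D.coroot β μ = -1 then g μ * ((e (μ + β - lam))⁻¹ * f (μ + β)) else 0 with ht
  have h1 : ∀ μ, g μ * f μ = g μ + ∑ β ∈ D.roots, t μ β := by
    intro μ
    by_cases h0 : g μ = 0
    · simp [ht, h0]
    · simp only [ht]
      rw [← Finset.sum_filter]
      change _ = g μ + ∑ β ∈ D.diagram μ, _
      rw [← Finset.mul_sum, hf]
      simp only
      rw [D.nkPhi_rec e μ _ (D.nk_reach_predom hlam (hreach μ h0)), mul_add, mul_one]
      congr 2
      refine Finset.sum_congr rfl fun β _ => ?_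
      rw [show μ - lam + β = μ + β - lam by abel]
  have htfin : ∀ β ∈ D.roots, (Function.support fun μ => t μ β).Finite := by
    intro β _
    refine hfin.subset fun μ hμ h0 => hμ ?_
    simp [ht, h0]
  have hgf : (Function.support fun μ => g μ * f μ).Finite :=
    hfin.subset fun μ hμ => left_ne_zero_of_mul hμ
  have htsum : (Function.support fun μ => ∑ β ∈ D.roots, t μ β).Finite := by
    refine hfin.subset fun μ hμ h0 => hμ ?_
    simp [ht, h0]
  have h2 : ∑ᶠ μ, g μ * f μ = ∑ᶠ μ, g μ + ∑ᶠ μ, ∑ β ∈ D.roots, t μ β := by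
    rw [← finsum_add_distrib hfin htsum]
    exact finsum_congr h1
  have hshift : ∀ β ∈ D.roots, ∑ᶠ μ, t μ β = ∑ᶠ μ, t (μ - β) β := fun β _ =>
    (finsum_comp_equiv (Equiv.subRight β) (f := fun μ => t μ β)).symm
  have h3 : ∑ᶠ μ, ∑ β ∈ D.roots, t μ β = ∑ᶠ μ, (if μ = lam then 0 else g μ * f μ) := by
    rw [finsum_sum_comm _ _ htfin, Finset.sum_congr rfl hshift, ← finsum_sum_comm]
    · refine finsum_congr fun μ => ?_
      have h4 : ∑ β ∈ D.roots, t (μ - β) β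
          = (e (μ - lam))⁻¹ * f μ * ∑ β ∈ D.nkE μ, g (μ - β) := by
        rw [nkE, Finset.sum_filter, Finset.mul_sum]
        refine Finset.sum_congr rfl fun β hβ => ?_
        have hiff : D.coroot β (μ - β) = -1 ↔ D.coroot β μ = 1 := by
          rw [map_sub, D.coroot_self β hβ]
          constructor <;> intro h <;> linarith
        simp only [ht, hiff, sub_add_cancel]
        split_ifs
        · ring
        · simp
      rw [h4, ← hrec]
      split_ifs with h
      · simp [h]
      · have : e (μ - lam) ≠ 0 := fun h5 =>
          h (sub_eq_zero.1 (he (by rw [h5, map_zero])))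
        field_simp
    · intro β hβ
      exact (htfin β hβ).preimage (sub_left_injective.injOn)
  have h5 : ∑ᶠ μ, g μ * f μ = g lam * f lam + ∑ᶠ μ, (if μ = lam then 0 else g μ * f μ) := by
    have e1 : ∑ᶠ μ, (if μ = lam then g lam * f lam else 0) = g lam * f lam := by
      rw [finsum_eq_single _ lam (fun μ h => if_neg h), if_pos rfl]
    rw [← e1, ← finsum_add_distrib]
    · refine finsum_congr fun μ => ?_
      split_ifs with h
      · rw [h, add_zero]
      · rw [zero_add]
    · refine (Set.finite_singleton lam).subset fun μ hμ => ?_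
      by_contra h
      exact hμ (if_neg h)
    · refine hgf.subset fun μ hμ h0 => hμ ?_
      simp only at h0
      simp only [h0, ite_self]
  have h6 : ∑ᶠ μ, g μ = g lam * f lam := by
    rw [h2, h3] at h5
    exact add_right_cancel h5
  rw [h6, hone, one_mul, hf]
  simp

end WeylSetting

/-- **Nakada's colored hook formula.** For a pre-dominant integral weight `λ`,
the sum over all `λ`-paths `(β₁, …, β_r)` (with `r ≥ 0`) of
`1/β₁ ⋅ 1/(β₁+β₂) ⋯ 1/(β₁+⋯+β_r)` equals `∏_{β ∈ D(λ)} (1 + 1/β)`,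
as an identity of rational functions. -/
theorem nakada_colored_hook_formula
    (D : WeylSetting) (lam : D.V) (hlam : D.IsPreDominant lam)
    (F : Type) [Field F] [Algebra ℚ F] (emb : D.V →ₗ[ℚ] F)
    (hemb : Function.Injective emb) :
    (∑ᶠ l : List D.V, if D.IsWeightPath lam l then D.pathTerm emb l else 0) =
      ∏ β ∈ D.diagram lam, (1 + (emb β)⁻¹) := by

  obtain ⟨g, hfin, hreach, hone, hrec, hsum⟩ :=
    D.nk_exists_g (F := F) _ lam hlam rfl emb hemb
  rw [← hsum, D.nk_duality lam hlam emb hemb g hfin hreach hone hrec]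
  unfold WeylSetting.nkPhi
  refine finsum_congr fun l => ?_
  rw [finsum_eq_if]
  simp [WeylSetting.nkT, WeylSetting.pathTerm]
end

section
/- Nakada's formula in Weyl-group form: Let π be a dominant integral weight and w ∈ W a π-minuscule element. Then the sum over all integers r ≥ 0 and all directed paths x_r →β_r x_{r−1} → ⋯ → x_1 →β_1 x_0 = w in W^π of the product (1/β_1)·(1/(β_1+β_2))·…·(1/(β_1+⋯+β_r)) equals ∏_{β ∈ S(w)} (1 + 1/β). In particular, the sum restricted to paths of maximal length d = |S(w)| = ℓ(w) equals ∏_{β ∈ S(w)} (1/β). -/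
open scoped Classical BigOperators

namespace NakadaAux

open WeylSetting

variable {D : WeylSetting}

/-- existence of the height functional -/
lemma exists_h (D : WeylSetting) : ∃ h : D.V →ₗ[ℚ] ℚ, ∀ i, h (D.simple i) = 1 := by
  have hb := D.simple_indep
  let b := Module.Basis.extend hb.linearIndepOn_id
  refine ⟨b.constr ℚ (fun _ => (1 : ℚ)), fun i => ?_⟩
  have hm : D.simple i ∈ hb.linearIndepOn_id.extend (Set.subset_univ (Set.range D.simple)) :=
    hb.linearIndepOn_id.subset_extend _ ⟨i, rfl⟩
  have : D.simple i = b ⟨D.simple i, hm⟩ := by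
    simp [b, Module.Basis.extend_apply_self]
  rw [this, Module.Basis.constr_basis]

/-- the height functional -/
noncomputable def h (D : WeylSetting) : D.V →ₗ[ℚ] ℚ := (exists_h D).choose

lemma h_simple (i : D.I) : h D (D.simple i) = 1 := (exists_h D).choose_spec i

lemma root_ne_zero {β : D.V} (hβ : β ∈ D.roots) : β ≠ 0 := by
  rintro rfl
  have := D.coroot_self 0 hβ
  simp at this

lemma pos_h {β : D.V} (hβ : D.IsPosRoot β) : 1 ≤ h D β := by
  have e := D.posCoeff_spec β hβ.1 hβ.2
  have hh : h D β = ((∑ i, D.posCoeff β i : ℕ) : ℚ) := by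
    conv_lhs => rw [e]
    simp [map_sum, h_simple]
  rw [hh]
  have : (∑ i, D.posCoeff β i) ≠ 0 := by
    intro h0
    have h1 : ∀ i, D.posCoeff β i = 0 := by simpa using h0
    apply root_ne_zero hβ.1
    rw [e]; simp [h1]
  exact_mod_cast Nat.one_le_iff_ne_zero.mpr this

lemma pos_or_neg {β : D.V} (hβ : β ∈ D.roots) : D.IsPosRoot β ∨ D.IsPosRoot (-β) := by
  rcases D.root_pos_or_neg β hβ with h | h
  · exact Or.inl ⟨hβ, h⟩
  · exact Or.inr ⟨D.roots_neg β hβ, h⟩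

lemma not_pos_neg {β : D.V} (h1 : D.IsPosRoot β) (h2 : D.IsPosRoot (-β)) : False := by
  have a := pos_h h1
  have b := pos_h h2
  rw [map_neg] at b
  linarith

lemma simple_pos (i : D.I) : D.IsPosRoot (D.simple i) :=
  ⟨D.simple_mem i, Pi.single i 1, fun j => by
    by_cases hj : j = i
    · subst hj; simp
    · simp [hj], by simp [Pi.single_apply]⟩

lemma act_mul (a b : D.W) (v : D.V) : D.act (a * b) v = D.act a (D.act b v) := by
  rw [map_mul]; rfl

lemma act_one (v : D.V) : D.act 1 v = v := by simp

lemma act_inv_act (a : D.W) (v : D.V) : D.act a⁻¹ (D.act a v) = v := by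
  rw [← act_mul]; simp

lemma act_act_inv (a : D.W) (v : D.V) : D.act a (D.act a⁻¹ v) = v := by
  rw [← act_mul]; simp

/-- invariant form -/
noncomputable def B (x y : D.V) : ℚ := ∑ δ ∈ D.roots, D.coroot δ x * D.coroot δ y

lemma B_inv (g : D.W) (x y : D.V) : B (D.act g x) (D.act g y) = B x y := by
  unfold B
  symm
  apply Finset.sum_bij (fun δ _ => D.act g δ)
  · intro δ hδ; exact D.roots_invariant g δ hδ
  · intro a _ b _ hab; exact (D.act g).injective hab
  · intro b hb
    exact ⟨D.act g⁻¹ b, D.roots_invariant _ b hb, act_act_inv _ _⟩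
  · intro δ hδ
    rw [D.coroot_equivariant g δ hδ, D.coroot_equivariant g δ hδ]

lemma B_self_pos {β : D.V} (hβ : β ∈ D.roots) : 0 < B β β := by
  unfold B
  apply Finset.sum_pos'
  · intro i _; exact mul_self_nonneg _
  · exact ⟨β, hβ, by rw [D.coroot_self β hβ]; norm_num⟩

lemma B_comm (x y : D.V) : B x y = B y x := by
  unfold B; exact Finset.sum_congr rfl fun _ _ => mul_comm _ _

lemma B_sub_left (x y z : D.V) : B (x - y) z = B x z - B y z := by
  unfold B; rw [← Finset.sum_sub_distrib]; exact Finset.sum_congr rfl fun _ _ => by rw [map_sub]; ring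

lemma B_smul_left (c : ℚ) (x z : D.V) : B (c • x) z = c * B x z := by
  unfold B; rw [Finset.mul_sum]; exact Finset.sum_congr rfl fun _ _ => by
    rw [map_smul, smul_eq_mul]; ring

lemma B_neg_left (x z : D.V) : B (-x) z = - B x z := by
  have := B_smul_left (-1) x z
  simpa using this

lemma srefl_self {β : D.V} (hβ : β ∈ D.roots) : D.act (D.srefl β) β = -β := by
  rw [D.srefl_apply β hβ, D.coroot_self β hβ]; module

lemma coroot_B {β : D.V} (hβ : β ∈ D.roots) (x : D.V) :
    2 * B x β = D.coroot β x * B β β := by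
  have h1 := B_inv (D.srefl β) x β
  rw [srefl_self hβ, D.srefl_apply β hβ, B_comm, B_neg_left, B_comm, B_sub_left, B_smul_left] at h1
  linarith

lemma coroot_smul {β : D.V} (hβ : β ∈ D.roots) {c : ℚ} (hc : c ≠ 0) (hcβ : c • β ∈ D.roots)
    (x : D.V) : c * D.coroot (c • β) x = D.coroot β x := by
  have h1 := coroot_B hβ x
  have h2 := coroot_B hcβ x
  have h3 := B_self_pos hβ
  rw [B_comm x, B_smul_left, B_comm _ x, B_smul_left, B_comm β (c • β), B_smul_left] at h2
  have : (c * D.coroot (c • β) x - D.coroot β x) * (c * B β β) = 0 := by linear_combination c * h1 - h2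
  rcases mul_eq_zero.mp this with h | h
  · linarith
  · rcases mul_eq_zero.mp h with h | h
    · exact absurd h hc
    · exact absurd h h3.ne'

lemma coroot_neg {β : D.V} (hβ : β ∈ D.roots) (x : D.V) : D.coroot (-β) x = - D.coroot β x := by
  have := coroot_smul hβ (c := -1) (by norm_num) (by simpa using D.roots_neg β hβ) x
  simp at this
  linarith

lemma coroot_sign {β γ : D.V} (hβ : β ∈ D.roots) (hγ : γ ∈ D.roots) (hp : 0 < D.coroot β γ) :
    0 < D.coroot γ β := by
  have h1 := coroot_B hβ γ
  have h2 := coroot_B hγ β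
  have h3 := B_self_pos hβ
  have h4 := B_self_pos hγ
  rw [B_comm] at h2
  have : 0 < D.coroot γ β * B γ γ := by rw [← h2, h1]; positivity
  exact pos_of_mul_pos_left this h4.le

lemma ext_act {a b : D.W} (hab : ∀ v, D.act a v = D.act b v) : a = b := by
  have : a * b⁻¹ = 1 := D.act_faithful _ fun v => by
    rw [act_mul, hab, act_act_inv]
  exact mul_inv_eq_one.mp this

lemma srefl_smul {β : D.V} (hβ : β ∈ D.roots) {c : ℚ} (hc : c ≠ 0) (hcβ : c • β ∈ D.roots) :
    D.srefl (c • β) = D.srefl β := by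
  apply ext_act
  intro v
  rw [D.srefl_apply _ hβ, D.srefl_apply _ hcβ, ← coroot_smul hβ hc hcβ v, smul_smul, mul_comm]

lemma srefl_neg {β : D.V} (hβ : β ∈ D.roots) : D.srefl (-β) = D.srefl β := by
  have := srefl_smul hβ (c := -1) (by norm_num) (by simpa using D.roots_neg β hβ)
  simpa using this

lemma srefl_conj (g : D.W) {β : D.V} (hβ : β ∈ D.roots) :
    D.srefl (D.act g β) = g * D.srefl β * g⁻¹ := by
  apply ext_act
  intro v
  rw [D.srefl_apply _ (D.roots_invariant g β hβ), act_mul, act_mul, D.srefl_apply _ hβ, map_sub,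
    act_act_inv, map_smul, ← D.coroot_equivariant g β hβ, act_act_inv]

lemma srefl_sq {β : D.V} (hβ : β ∈ D.roots) : D.srefl β * D.srefl β = 1 := by
  apply ext_act
  intro v
  rw [act_mul, D.srefl_apply _ hβ v, map_sub, map_smul, srefl_self hβ, D.srefl_apply _ hβ v, act_one]
  module

lemma srefl_srefl {β : D.V} (hβ : β ∈ D.roots) (v : D.V) :
    D.act (D.srefl β) (D.act (D.srefl β) v) = v := by
  rw [← act_mul, srefl_sq hβ, act_one]

lemma coroot_refl {β γ : D.V} (hβ : β ∈ D.roots) (hγ : γ ∈ D.roots) (v : D.V) :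
    D.coroot γ (D.act (D.srefl β) v) = D.coroot (D.act (D.srefl β) γ) v := by
  rw [← D.coroot_equivariant (D.srefl β) γ hγ, srefl_srefl hβ]

lemma s_sq (i : D.I) : D.s i * D.s i = 1 := srefl_sq (D.simple_mem i)

lemma s_s (i : D.I) (v : D.V) : D.act (D.s i) (D.act (D.s i) v) = v :=
  srefl_srefl (D.simple_mem i) v

lemma s_apply (i : D.I) (v : D.V) :
    D.act (D.s i) v = v - D.coroot (D.simple i) v • D.simple i :=
  D.srefl_apply _ (D.simple_mem i) v

lemma s_simple (i : D.I) : D.act (D.s i) (D.simple i) = - D.simple i :=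
  srefl_self (D.simple_mem i)

/-- a simple reflection keeps a positive root positive unless it is a multiple of the simple root -/
lemma s_pos_or (i : D.I) {β : D.V} (hβ : D.IsPosRoot β) :
    D.IsPosRoot (D.act (D.s i) β) ∨ ∃ c : ℕ, 1 ≤ c ∧ β = (c : ℚ) • D.simple i := by
  rcases pos_or_neg (D.roots_invariant (D.s i) β hβ.1) with hp | hn
  · exact Or.inl hp
  right
  obtain ⟨-, d, hd0, hd⟩ := hn
  have e := D.posCoeff_spec β hβ.1 hβ.2
  have key : ∑ k, ((D.posCoeff β k : ℚ) + d k - Pi.single (M := fun _ => ℚ) i (D.coroot (D.simple i) β) k)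
      • D.simple k = 0 := by
    simp only [sub_smul, add_smul, Finset.sum_add_distrib, Finset.sum_sub_distrib]
    rw [← e, ← hd, s_apply]
    simp [Pi.single_apply]
  have hk := (Fintype.linearIndependent_iff.mp D.simple_indep) _ key
  have hz : ∀ k, k ≠ i → D.posCoeff β k = 0 := by
    intro k hki
    have h1 := hk k
    simp only [Pi.single_apply, hki, if_false, sub_zero] at h1
    have h2 := hd0 k
    have h3 : (0 : ℚ) ≤ D.posCoeff β k := Nat.cast_nonneg _
    have : (D.posCoeff β k : ℚ) = 0 := by linarith
    exact_mod_cast this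
  have e2 : β = (D.posCoeff β i : ℚ) • D.simple i := by
    conv_lhs => rw [e]
    apply Finset.sum_eq_single_of_mem i (Finset.mem_univ _)
    intro k _ hki
    simp [hz k hki]
  refine ⟨_, ?_, e2⟩
  rw [Nat.one_le_iff_ne_zero]
  intro h0
  rw [h0] at e2
  exact root_ne_zero hβ.1 (by simpa using e2)

lemma coroot_mult {i : D.I} {β : D.V} (hβ : D.IsPosRoot β) {c : ℕ} (hc : 1 ≤ c)
    (e : β = (c : ℚ) • D.simple i) (v : D.V) : c * D.coroot β v = D.coroot (D.simple i) v := by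
  subst e
  exact coroot_smul (D.simple_mem i) (by positivity) hβ.1 v

lemma srefl_mult {i : D.I} {β : D.V} (hβ : D.IsPosRoot β) {c : ℕ} (hc : 1 ≤ c)
    (e : β = (c : ℚ) • D.simple i) : D.srefl β = D.s i := by
  subst e
  exact srefl_smul (D.simple_mem i) (by positivity) hβ.1

/-! ### length -/

lemma exists_reduced (g : D.W) : ∃ l, D.IsReduced l g := by
  have hne : {n | ∃ l : List D.I, l.length = n ∧ D.wordProd l = g}.Nonempty := by
    obtain ⟨l, hl⟩ := D.generated g
    exact ⟨_, l, rfl, hl.symm⟩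
  obtain ⟨l, h1, h2⟩ := Nat.sInf_mem hne
  exact ⟨l, h2, h1⟩

lemma length_le (l : List D.I) : D.length (D.wordProd l) ≤ l.length :=
  Nat.sInf_le ⟨l, rfl, rfl⟩

lemma wordProd_cons (i : D.I) (l : List D.I) : D.wordProd (i :: l) = D.s i * D.wordProd l := by
  simp [wordProd]

lemma wordProd_append (l l' : List D.I) :
    D.wordProd (l ++ l') = D.wordProd l * D.wordProd l' := by
  simp [wordProd]

lemma delete_letter (l : List D.I) : ∀ β : D.V, D.IsPosRoot β →
    D.IsPosRoot (-(D.act (D.wordProd l)⁻¹ β)) →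
    ∃ l' : List D.I, l'.length + 1 = l.length ∧ D.wordProd l' = D.srefl β * D.wordProd l := by
  induction l with
  | nil =>
    intro β h1 h2
    exfalso
    apply not_pos_neg h1
    simpa [wordProd] using h2
  | cons i l ih =>
    intro β h1 h2
    have hsi : (D.s i)⁻¹ = D.s i := inv_eq_of_mul_eq_one_left (s_sq i)
    rcases s_pos_or i h1 with hp | ⟨c, hc, e⟩
    · have h3 : D.IsPosRoot (-(D.act (D.wordProd l)⁻¹ (D.act (D.s i) β))) := by
        rw [wordProd_cons, mul_inv_rev, act_mul, hsi] at h2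
        exact h2
      obtain ⟨l', hl', e'⟩ := ih _ hp h3
      refine ⟨i :: l', by simp [hl'], ?_⟩
      rw [wordProd_cons, e', srefl_conj _ h1.1, wordProd_cons, hsi]
      have := s_sq i
      simp only [← mul_assoc, this, one_mul]
    · refine ⟨l, by simp, ?_⟩
      rw [srefl_mult h1 hc e, wordProd_cons, ← mul_assoc, s_sq, one_mul]

lemma length_lt {w : D.W} {β : D.V} (hβ : D.IsPosRoot β) (hn : D.IsPosRoot (-(D.act w⁻¹ β))) :
    D.length (D.srefl β * w) < D.length w := by
  obtain ⟨l, hl, hlen⟩ := exists_reduced w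
  subst hl
  obtain ⟨l', h1, h2⟩ := delete_letter l β hβ hn
  rw [← h2]
  have := length_le l'
  omega

lemma length_gt {w : D.W} {β : D.V} (hβ : D.IsPosRoot β) (hn : D.IsPosRoot (D.act w⁻¹ β)) :
    D.length w < D.length (D.srefl β * w) := by
  have := length_lt (w := D.srefl β * w) hβ (by
    rw [mul_inv_rev, act_mul, inv_eq_of_mul_eq_one_left (srefl_sq hβ.1), srefl_self hβ.1, map_neg,
      neg_neg]
    exact hn)
  rwa [← mul_assoc, srefl_sq hβ.1, one_mul] at this

lemma exists_descent {x : D.W} (hx : x ≠ 1) :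
    ∃ (y : D.W) (i : D.I), x = y * D.s i ∧ D.length y < D.length x ∧
      D.IsPosRoot (D.act y (D.simple i)) := by
  obtain ⟨l, hl, hlen⟩ := exists_reduced x
  rcases List.eq_nil_or_concat l with rfl | ⟨l', i, rfl⟩
  · exact absurd hl.symm (by simpa [wordProd] using hx)
  have e : x = D.wordProd l' * D.s i := by
    rw [← hl, List.concat_eq_append, wordProd_append]; simp [wordProd]
  have hlt : D.length (D.wordProd l') < D.length x := by
    have := length_le l'
    simp at hlen
    omega
  refine ⟨_, i, e, hlt, ?_⟩
  rcases pos_or_neg (D.roots_invariant (D.wordProd l') _ (D.simple_mem i)) with hp | hn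
  · exact hp
  exfalso
  have h1 := length_lt (w := D.wordProd l') hn (by
    rw [map_neg, act_inv_act, neg_neg]; exact simple_pos i)
  rw [srefl_neg (D.roots_invariant _ _ (D.simple_mem i)), srefl_conj _ (D.simple_mem i),
    inv_mul_cancel_right] at h1
  rw [e] at hlt
  exact absurd h1 (by unfold s at hlt; omega)

lemma eq_one_of_pos {x : D.W} (hx : ∀ i, D.IsPosRoot (D.act x (D.simple i))) : x = 1 := by
  by_contra hne
  obtain ⟨y, i, e, -, hp⟩ := exists_descent hne
  have := hx i
  rw [e, act_mul, s_simple, map_neg] at this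
  exact not_pos_neg hp this

lemma h_orbit {pi : D.V} (hpi : D.IsDominant pi) (n : ℕ) :
    ∀ g : D.W, D.length g = n → h D (D.act g pi) ≤ h D pi := by
  induction n using Nat.strong_induction_on with
  | _ n ih =>
    intro g hg
    by_cases h1 : g = 1
    · rw [h1, act_one]
    obtain ⟨y, i, e, hlt, hp⟩ := exists_descent h1
    have h2 := ih _ (hg ▸ hlt) y rfl
    rw [e, act_mul, s_apply, map_sub, map_smul, map_sub, map_smul, smul_eq_mul]
    have h3 := pos_h hp
    have h4 := hpi.2 i
    nlinarith

lemma dom_nonneg {pi : D.V} (hpi : D.IsDominant pi) {β : D.V} (hβ : D.IsPosRoot β) :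
    0 ≤ D.coroot β pi := by
  have h1 := h_orbit hpi _ (D.srefl β) rfl
  rw [D.srefl_apply _ hβ.1, map_sub, map_smul, smul_eq_mul] at h1
  have h2 := pos_h hβ
  by_contra h3
  push Not at h3
  nlinarith

/-! ### Bruhat order -/

lemma bruhat_length {a b : D.W} (hab : D.bruhatLE a b) : D.length a ≤ D.length b := by
  induction hab with
  | refl => exact le_rfl
  | tail _ h ih => exact ih.trans h.2.le

lemma bruhatLT_length {a b : D.W} (hab : D.bruhatLT a b) : D.length a < D.length b := by
  obtain ⟨h1, h2⟩ := hab
  rcases Relation.ReflTransGen.cases_tail h1 with h | ⟨c, hc, hs⟩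
  · exact absurd h.symm h2
  · exact (bruhat_length hc).trans_lt hs.2

lemma bruhat_step {w : D.W} {β : D.V} (hβ : D.IsPosRoot β)
    (hlt : D.length (D.srefl β * w) < D.length w) : D.bruhatLE (D.srefl β * w) w := by
  apply Relation.ReflTransGen.single
  exact ⟨⟨β, hβ, by rw [← mul_assoc, srefl_sq hβ.1, one_mul]⟩, hlt⟩

lemma bruhatLT_iff {w : D.W} {β : D.V} (hβ : D.IsPosRoot β) :
    D.bruhatLT (D.srefl β * w) w ↔ D.IsPosRoot (-(D.act w⁻¹ β)) := by
  constructor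
  · intro hb
    rcases pos_or_neg (D.roots_invariant w⁻¹ β hβ.1) with hp | hn
    · have := bruhatLT_length hb
      have := length_gt hβ hp
      omega
    · exact hn
  · intro hn
    have := length_lt hβ hn
    exact ⟨bruhat_step hβ this, fun e => by rw [e] at this; omega⟩


/-! ### minimal representatives -/

lemma integral_act {pi : D.V} (hpi : D.IsIntegral pi) (g : D.W) : D.IsIntegral (D.act g pi) := by
  intro β hβ
  have e : D.coroot β (D.act g pi) = D.coroot (D.act g⁻¹ β) pi := by
    rw [← D.coroot_equivariant g⁻¹ β hβ.1, act_inv_act]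
  rw [e]
  have hr := D.roots_invariant g⁻¹ β hβ.1
  rcases pos_or_neg hr with hp | hn
  · exact hpi _ hp
  · obtain ⟨n, hn⟩ := hpi _ hn
    rw [coroot_neg hr] at hn
    exact ⟨-n, by push_cast; linarith⟩

lemma coroot_act (g : D.W) {β : D.V} (hβ : β ∈ D.roots) (v : D.V) :
    D.coroot β (D.act g v) = D.coroot (D.act g⁻¹ β) v := by
  rw [← D.coroot_equivariant g⁻¹ β hβ, act_inv_act]

lemma neg_of_inv {pi : D.V} (hpi : D.IsDominant pi) {g : D.W} {β : D.V} (hβ : D.IsPosRoot β)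
    (hn : D.IsPosRoot (-(D.act g⁻¹ β))) : D.coroot β (D.act g pi) ≤ 0 := by
  have := dom_nonneg hpi hn
  rw [coroot_neg (D.roots_invariant _ _ hβ.1), ← coroot_act g hβ.1] at this
  linarith

lemma inv_of_neg {pi : D.V} (hpi : D.IsDominant pi) {g : D.W} {β : D.V} (hβ : D.IsPosRoot β)
    (hn : D.coroot β (D.act g pi) < 0) : D.IsPosRoot (-(D.act g⁻¹ β)) := by
  rcases pos_or_neg (D.roots_invariant g⁻¹ β hβ.1) with hp | h
  · have := dom_nonneg hpi hp
    rw [← coroot_act g hβ.1] at this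
    linarith
  · exact h

/-- all inversions pair strictly negatively with the weight -/
def Good (pi : D.V) (u : D.W) : Prop :=
  ∀ β, D.IsPosRoot β → D.IsPosRoot (-(D.act u⁻¹ β)) → D.coroot β (D.act u pi) < 0

lemma mem_stab_iff {pi : D.V} {a b : D.W} :
    a⁻¹ * b ∈ D.stab pi ↔ D.act a pi = D.act b pi := by
  change D.act (a⁻¹ * b) pi = pi ↔ _
  rw [act_mul]
  constructor
  · intro e
    conv_lhs => rw [← e]
    rw [act_act_inv]
  · intro e
    rw [← e, act_inv_act]

lemma not_good {pi : D.V} (hpi : D.IsDominant pi) {u : D.W} (hu : ¬ Good pi u) :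
    ∃ β, D.IsPosRoot β ∧ D.length (D.srefl β * u) < D.length u ∧
      D.act (D.srefl β * u) pi = D.act u pi := by
  unfold Good at hu
  push Not at hu
  obtain ⟨β, hβ, hn, h0⟩ := hu
  have h1 := neg_of_inv hpi hβ hn
  refine ⟨β, hβ, length_lt hβ hn, ?_⟩
  have : D.coroot β (D.act u pi) = 0 := le_antisymm h1 h0
  rw [act_mul, D.srefl_apply _ hβ.1, this]; simp

lemma good_of_minRep {pi : D.V} (hpi : D.IsDominant pi) {u : D.W}
    (hu : D.IsMinRep (D.stab pi) u) : Good pi u := by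
  by_contra hng
  obtain ⟨β, -, hlt, e⟩ := not_good hpi hng
  have := hu _ (mem_stab_iff.mpr e.symm)
  omega

lemma good_unique {pi : D.V} (hpi : D.IsDominant pi) {u v : D.W}
    (hu : Good pi u) (hv : Good pi v) (e : D.act u pi = D.act v pi) : u = v := by
  have hI : ∀ β, D.IsPosRoot β → (D.IsPosRoot (-(D.act u⁻¹ β)) ↔ D.IsPosRoot (-(D.act v⁻¹ β))) := by
    intro β hβ
    constructor
    · intro hn
      exact inv_of_neg hpi hβ (e ▸ hu β hβ hn)
    · intro hn
      exact inv_of_neg hpi hβ (e ▸ hv β hβ hn)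
  have : u⁻¹ * v = 1 := by
    apply eq_one_of_pos
    intro i
    rw [act_mul]
    have hr := D.roots_invariant v _ (D.simple_mem i)
    have hr' := D.roots_invariant u⁻¹ _ hr
    rcases pos_or_neg hr with hp | hn
    · rcases pos_or_neg hr' with h1 | h1
      · exact h1
      · have := (hI _ hp).mp h1
        rw [act_inv_act] at this
        exact (not_pos_neg (simple_pos i) this).elim
    · have := (hI _ hn).mpr (by
        rw [map_neg, act_inv_act, neg_neg]; exact simple_pos i)
      rwa [map_neg, neg_neg] at this
  exact inv_mul_eq_one.mp this

lemma exists_good_le {pi : D.V} (hpi : D.IsDominant pi) (n : ℕ) :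
    ∀ g : D.W, D.length g = n →
      ∃ u, Good pi u ∧ D.act u pi = D.act g pi ∧ D.bruhatLE u g := by
  induction n using Nat.strong_induction_on with
  | _ n ih =>
    intro g hg
    by_cases h1 : Good pi g
    · exact ⟨g, h1, rfl, Relation.ReflTransGen.refl⟩
    obtain ⟨β, hβ, hlt, e⟩ := not_good hpi h1
    obtain ⟨u, hu, e', hle⟩ := ih _ (hg ▸ hlt) _ rfl
    exact ⟨u, hu, e'.trans e, Relation.ReflTransGen.trans hle (bruhat_step hβ hlt)⟩

lemma minRep_of_good {pi : D.V} (hpi : D.IsDominant pi) {u : D.W}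
    (hu : Good pi u) : D.IsMinRep (D.stab pi) u := by
  intro g hg
  obtain ⟨v, hv, e, hle⟩ := exists_good_le hpi _ g rfl
  have : u = v := good_unique hpi hu hv ((mem_stab_iff.mp hg).trans e.symm)
  rw [this]
  exact bruhat_length hle

lemma good_lt {pi : D.V} (hpi : D.IsDominant pi) {u w : D.W} {β : D.V} (hβ : D.IsPosRoot β)
    (hu : Good pi u) (hn : D.coroot β (D.act w pi) < 0)
    (e : D.act u pi = D.act (D.srefl β * w) pi) : D.bruhatLT u w := by
  have h1 := length_lt hβ (inv_of_neg hpi hβ hn)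
  obtain ⟨v, hv, e', hle⟩ := exists_good_le hpi _ (D.srefl β * w) rfl
  have : u = v := good_unique hpi hu hv (e.trans e'.symm)
  subst this
  refine ⟨Relation.ReflTransGen.trans hle (bruhat_step hβ h1), ?_⟩
  rintro rfl
  have := bruhat_length hle
  omega

lemma arrow_iff {pi : D.V} (hpi : D.IsDominant pi) {u w : D.W} {β : D.V} (hw : Good pi w) :
    D.Arrow (D.stab pi) u w β ↔ D.IsPosRoot β ∧ Good pi u ∧
      D.act u pi = D.act (D.srefl β) (D.act w pi) ∧ D.coroot β (D.act w pi) < 0 := by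
  constructor
  · rintro ⟨hβ, hu, -, hc, hlt⟩
    have hu := good_of_minRep hpi hu
    have e := mem_stab_iff.mp hc
    refine ⟨hβ, hu, by rw [← e, act_mul], ?_⟩
    rw [act_mul] at e
    by_contra hge
    push Not at hge
    rcases hge.eq_or_lt with h0 | h0
    · apply hlt.2
      apply good_unique hpi hu hw
      rw [← e, D.srefl_apply _ hβ.1, ← h0]; simp
    · have := good_lt hpi (u := w) (w := u) hβ hw (by
        rw [← e, coroot_refl hβ.1 hβ.1, srefl_self hβ.1, coroot_neg hβ.1]; linarith) (by
        rw [act_mul, ← e, srefl_srefl hβ.1])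
      have h1 := bruhatLT_length this
      have h2 := bruhatLT_length hlt
      omega
  · rintro ⟨hβ, hu, e, hn⟩
    exact ⟨hβ, minRep_of_good hpi hu, minRep_of_good hpi hw,
      mem_stab_iff.mpr (by rw [act_mul, e]), good_lt hpi hβ hu hn (by rw [act_mul, e])⟩

/-! ### pre-dominant weights -/

lemma refl_eq_add {lam β : D.V} (hβ : D.IsPosRoot β) (e : D.coroot β lam = -1) :
    D.act (D.srefl β) lam = lam + β := by
  rw [D.srefl_apply _ hβ.1, e]; module

lemma preDom_step {lam β : D.V} (hl : D.IsPreDominant lam) (hβ : D.IsPosRoot β)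
    (e : D.coroot β lam = -1) : D.IsPreDominant (D.act (D.srefl β) lam) := by
  refine ⟨integral_act hl.1 _, fun γ hγ => ?_⟩
  rcases pos_or_neg (D.roots_invariant (D.srefl β) γ hγ.1) with hp | hn
  · rw [coroot_refl hβ.1 hγ.1]
    exact hl.2 _ hp
  · have h1 : 0 < D.coroot β γ := by
      have a := pos_h hn
      rw [D.srefl_apply _ hβ.1, map_neg, map_sub, map_smul, smul_eq_mul] at a
      have b := pos_h hβ
      have c := pos_h hγ
      by_contra h
      push Not at h
      nlinarith
    have h2 := coroot_sign hβ.1 hγ.1 h1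
    rw [refl_eq_add hβ e, map_add]
    have := hl.2 _ hγ
    linarith

lemma eq_neg_one {lam β : D.V} (hl : D.IsPreDominant lam) (hβ : D.IsPosRoot β)
    (hn : D.coroot β lam < 0) : D.coroot β lam = -1 := by
  obtain ⟨n, e⟩ := hl.1 β hβ
  have h2 := hl.2 β hβ
  rw [e] at hn h2 ⊢
  have a : n < 0 := by exact_mod_cast hn
  have b : -1 ≤ n := by exact_mod_cast h2
  have : n = -1 := by omega
  rw [this]; simp

lemma arrowPath_iff {pi : D.V} (hpi : D.IsDominant pi) (l : List D.V) : ∀ w : D.W, Good pi w →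
    D.IsPreDominant (D.act w pi) →
    (D.ArrowPath (D.stab pi) w l ↔ D.IsWeightPath (D.act w pi) l) := by
  induction l with
  | nil => intro w _ _; simp [ArrowPath, IsWeightPath]
  | cons β l ih =>
    intro w hw hd
    simp only [ArrowPath, IsWeightPath]
    constructor
    · rintro ⟨u, ha, hp⟩
      obtain ⟨hβ, hu, e, hn⟩ := (arrow_iff hpi hw).mp ha
      have h1 := eq_neg_one hd hβ hn
      refine ⟨hβ, h1, ?_⟩
      rw [← e]
      exact (ih u hu (by rw [e]; exact preDom_step hd hβ h1)).mp hp
    · rintro ⟨hβ, h1, hp⟩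
      obtain ⟨u, hu, e, -⟩ := exists_good_le hpi _ (D.srefl β * w) rfl
      rw [act_mul] at e
      refine ⟨u, (arrow_iff hpi hw).mpr ⟨hβ, hu, e, by rw [h1]; norm_num⟩, ?_⟩
      exact (ih u hu (by rw [e]; exact preDom_step hd hβ h1)).mpr (by rw [e]; exact hp)

/-! ### minuscule words -/

/-- recursive form of the minuscule condition -/
def MinWord (pi : D.V) : List D.I → Prop
  | [] => True
  | i :: l => D.coroot (D.simple i) (D.act (D.wordProd l) pi) = 1 ∧ MinWord pi l

lemma minWord_of {pi : D.V} (l : List D.I)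
    (hl : ∀ k : Fin l.length,
      D.coroot (D.simple (l.get k)) (D.act (D.wordProd (l.drop (k.val + 1))) pi) = 1) :
    MinWord pi l := by
  induction l with
  | nil => trivial
  | cons i l ih =>
    refine ⟨by simpa using hl ⟨0, by simp⟩, ih fun k => ?_⟩
    have := hl k.succ
    simpa using this

lemma coroot_s {i : D.I} {β : D.V} (hβ : β ∈ D.roots) (v : D.V) :
    D.coroot β (D.act (D.s i) v) = D.coroot (D.act (D.s i) β) v :=
  coroot_refl (D.simple_mem i) hβ v

lemma coroot_s_simple (i : D.I) (v : D.V) :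
    D.coroot (D.simple i) (D.act (D.s i) v) = - D.coroot (D.simple i) v := by
  rw [coroot_s (D.simple_mem i), s_simple, coroot_neg (D.simple_mem i)]

lemma minWord_good {pi : D.V} (l : List D.I) (hl : MinWord pi l) : Good pi (D.wordProd l) := by
  induction l with
  | nil =>
    intro β h1 h2
    exfalso
    apply not_pos_neg h1
    simpa [wordProd] using h2
  | cons i l ih =>
    intro β h1 h2
    have hsi : (D.s i)⁻¹ = D.s i := inv_eq_of_mul_eq_one_left (s_sq i)
    rw [wordProd_cons, mul_inv_rev, act_mul, hsi] at h2
    rw [wordProd_cons, act_mul]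
    rcases s_pos_or i h1 with hp | ⟨c, hc, e⟩
    · rw [coroot_s h1.1]
      exact ih hl.2 _ hp h2
    · have h3 := coroot_mult h1 hc e (D.act (D.s i) (D.act (D.wordProd l) pi))
      rw [coroot_s_simple, hl.1] at h3
      have hc' : (1 : ℚ) ≤ c := by exact_mod_cast hc
      by_contra h4
      push Not at h4
      nlinarith

lemma preDom_back {lam : D.V} (hl : D.IsPreDominant lam) {i : D.I}
    (e : D.coroot (D.simple i) lam = 1) : D.IsPreDominant (D.act (D.s i) lam) := by
  refine ⟨integral_act hl.1 _, fun γ hγ => ?_⟩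
  rcases s_pos_or i hγ with hp | ⟨c, hc, ec⟩
  · rw [coroot_s hγ.1]
    exact hl.2 _ hp
  · have h3 := coroot_mult hγ hc ec (D.act (D.s i) lam)
    rw [coroot_s_simple, e] at h3
    have hc' : (1 : ℚ) ≤ c := by exact_mod_cast hc
    by_contra h4
    push Not at h4
    nlinarith

lemma preDom_of_dom {pi : D.V} (hpi : D.IsDominant pi) : D.IsPreDominant pi :=
  ⟨hpi.1, fun β hβ => by have := dom_nonneg hpi hβ; linarith⟩

lemma minWord_preDom {pi : D.V} (hpi : D.IsDominant pi) (l : List D.I) (hl : MinWord pi l) :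
    D.IsPreDominant (D.act (D.wordProd l) pi) := by
  induction l with
  | nil => simpa [wordProd] using preDom_of_dom hpi
  | cons i l ih =>
    rw [wordProd_cons, act_mul]
    exact preDom_back (ih hl.2) hl.1

lemma diagram_dom {pi : D.V} (hpi : D.IsDominant pi) : D.diagram pi = ∅ := by
  unfold diagram
  rw [Finset.filter_eq_empty_iff]
  rintro β - ⟨hβ, e⟩
  have := dom_nonneg hpi hβ
  rw [e] at this
  norm_num at this

lemma mem_diagram {lam β : D.V} :
    β ∈ D.diagram lam ↔ D.IsPosRoot β ∧ D.coroot β lam = -1 := by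
  unfold diagram
  rw [Finset.mem_filter]
  exact ⟨fun h => h.2, fun h => ⟨h.1.1, h⟩⟩

lemma diagram_back {lam : D.V} {i : D.I} (e : D.coroot (D.simple i) lam = 1) :
    D.diagram (D.act (D.s i) lam) =
      insert (D.simple i) ((D.diagram lam).image fun β => D.act (D.s i) β) := by
  ext β
  rw [Finset.mem_insert, Finset.mem_image, mem_diagram]
  constructor
  · rintro ⟨hβ, h1⟩
    rcases s_pos_or i hβ with hp | ⟨c, hc, ec⟩
    · right
      refine ⟨_, mem_diagram.mpr ⟨hp, ?_⟩, s_s i β⟩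
      rw [← coroot_s hβ.1, h1]
    · left
      have h3 := coroot_mult hβ hc ec (D.act (D.s i) lam)
      rw [coroot_s_simple, e, h1] at h3
      have : (c : ℚ) = 1 := by linarith
      rw [ec, this, one_smul]
  · rintro (rfl | ⟨γ, hγ, rfl⟩)
    · exact ⟨simple_pos i, by rw [coroot_s_simple, e]⟩
    · rw [mem_diagram] at hγ
      rcases s_pos_or i hγ.1 with hp | ⟨c, hc, ec⟩
      · exact ⟨hp, by rw [D.coroot_equivariant _ _ hγ.1.1, hγ.2]⟩
      · exfalso
        have h3 := coroot_mult hγ.1 hc ec lam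
        rw [e, hγ.2] at h3
        have hc' : (1 : ℚ) ≤ c := by exact_mod_cast hc
        linarith

lemma simple_not_mem {lam : D.V} {i : D.I} :
    D.simple i ∉ (D.diagram lam).image fun β => D.act (D.s i) β := by
  rw [Finset.mem_image]
  rintro ⟨γ, hγ, e⟩
  rw [mem_diagram] at hγ
  have : γ = -D.simple i := by rw [← s_simple, ← e, s_s]
  exact not_pos_neg (simple_pos i) (this ▸ hγ.1)

lemma diagram_card {pi : D.V} (hpi : D.IsDominant pi) (l : List D.I) (hl : MinWord pi l) :
    (D.diagram (D.act (D.wordProd l) pi)).card = l.length := by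
  induction l with
  | nil => simp [wordProd, diagram_dom hpi]
  | cons i l ih =>
    rw [wordProd_cons, act_mul, diagram_back hl.1, Finset.card_insert_of_notMem simple_not_mem,
      Finset.card_image_of_injective _ (D.act (D.s i)).injective, ih hl.2, List.length_cons]

lemma Sset_eq {pi : D.V} (hpi : D.IsDominant pi) {w : D.W} (hw : Good pi w)
    (hd : D.IsPreDominant (D.act w pi)) : D.Sset w = D.diagram (D.act w pi) := by
  ext β
  unfold Sset
  rw [Finset.mem_filter, mem_diagram]
  constructor
  · rintro ⟨-, hβ, hlt⟩
    exact ⟨hβ, eq_neg_one hd hβ (hw β hβ ((bruhatLT_iff hβ).mp hlt))⟩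
  · rintro ⟨hβ, e⟩
    exact ⟨hβ.1, hβ, (bruhatLT_iff hβ).mpr (inv_of_neg hpi hβ (by rw [e]; norm_num))⟩

/-! ### weight paths -/

lemma path_append {β : D.V} (l : List D.V) : ∀ lam : D.V,
    (D.IsWeightPath lam (l ++ [β]) ↔
      D.IsWeightPath lam l ∧ D.IsPosRoot β ∧ D.coroot β (lam + l.sum) = -1) := by
  induction l with
  | nil => intro lam; simp [IsWeightPath]
  | cons γ l ih =>
    intro lam
    simp only [List.cons_append, IsWeightPath, List.sum_cons]
    constructor
    · rintro ⟨h1, h2, h3⟩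
      rw [ih, refl_eq_add h1 h2, add_assoc] at h3
      rw [refl_eq_add h1 h2]
      exact ⟨⟨h1, h2, h3.1⟩, h3.2⟩
    · rintro ⟨⟨h1, h2, h3⟩, h4⟩
      rw [refl_eq_add h1 h2] at h3 ⊢
      refine ⟨h1, h2, ?_⟩
      rw [ih, add_assoc]
      exact ⟨h3, h4⟩

lemma path_preDom (l : List D.V) : ∀ lam : D.V, D.IsPreDominant lam → D.IsWeightPath lam l →
    D.IsPreDominant (lam + l.sum) := by
  induction l with
  | nil => intro lam h _; simpa using h
  | cons γ l ih =>
    rintro lam hd ⟨h1, h2, h3⟩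
    have := ih _ (preDom_step hd h1 h2) h3
    rwa [refl_eq_add h1 h2, add_assoc] at this

lemma path_orbit (l : List D.V) : ∀ lam : D.V, D.IsWeightPath lam l →
    ∃ g : D.W, lam + l.sum = D.act g lam := by
  induction l with
  | nil => intro lam _; exact ⟨1, by simp⟩
  | cons γ l ih =>
    rintro lam ⟨h1, h2, h3⟩
    obtain ⟨g, hg⟩ := ih _ h3
    refine ⟨g * D.srefl γ, ?_⟩
    rw [act_mul, ← hg, refl_eq_add h1 h2, List.sum_cons, add_assoc]

lemma path_h (l : List D.V) : ∀ lam : D.V, D.IsWeightPath lam l →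
    (l.length : ℚ) ≤ h D l.sum := by
  induction l with
  | nil => intro lam _; simp
  | cons γ l ih =>
    rintro lam ⟨h1, h2, h3⟩
    have a := ih _ h3
    have b := pos_h h1
    rw [List.sum_cons, map_add]
    push_cast [List.length_cons]
    linarith

lemma path_roots (l : List D.V) : ∀ lam : D.V, D.IsWeightPath lam l → ∀ β ∈ l, β ∈ D.roots := by
  induction l with
  | nil => intro lam _; simp
  | cons γ l ih =>
    rintro lam ⟨h1, h2, h3⟩ β hβ
    rcases List.mem_cons.mp hβ with rfl | hm
    · exact h1.1
    · exact ih _ h3 β hm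

lemma path_finite {pi : D.V} (hpi : D.IsDominant pi) (w : D.W) :
    {l | D.IsWeightPath (D.act w pi) l}.Finite := by
  obtain ⟨N, hN⟩ := exists_nat_ge (h D pi - h D (D.act w pi))
  have hf : {l : List {x // x ∈ D.roots} | l.length ≤ N}.Finite := List.finite_length_le _ N
  apply (hf.image (List.map Subtype.val)).subset
  intro l hl
  have hl : D.IsWeightPath (D.act w pi) l := hl
  refine ⟨l.attach.map fun x => ⟨x.1, path_roots l _ hl x.1 x.2⟩, ?_, ?_⟩
  · change List.length _ ≤ N
    rw [List.length_map, List.length_attach]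
    obtain ⟨g, hg⟩ := path_orbit l _ hl
    have a := path_h l _ hl
    rw [← act_mul] at hg
    have b := h_orbit hpi _ (g * w) rfl
    rw [← hg, map_add] at b
    have : (l.length : ℚ) ≤ N := by linarith
    exact_mod_cast this
  · simp

lemma path_reflect {lam : D.V} {i : D.I} (e : D.coroot (D.simple i) lam = -1) (l : List D.V) :
    D.IsWeightPath lam l →
      ∃ l', D.IsWeightPath lam l' ∧ lam + l'.sum = D.act (D.s i) (lam + l.sum) := by
  induction l using List.reverseRecOn with
  | nil =>
    intro _
    refine ⟨[D.simple i], ⟨simple_pos i, e, trivial⟩, ?_⟩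
    rw [List.sum_nil, add_zero, s_apply, e]; simp
  | append_singleton l β ih =>
    intro hl
    rw [path_append] at hl
    obtain ⟨h1, hβ, h3⟩ := hl
    obtain ⟨l', hl', e'⟩ := ih h1
    rcases s_pos_or i hβ with hp | ⟨c, hc, ec⟩
    · refine ⟨l' ++ [D.act (D.s i) β], ?_, ?_⟩
      · rw [path_append, e', D.coroot_equivariant _ _ hβ.1]
        exact ⟨hl', hp, h3⟩
      · simp only [List.sum_append, List.sum_singleton]
        rw [← add_assoc, e', ← add_assoc, map_add _ _ β]
    · refine ⟨l, h1, ?_⟩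
      simp only [List.sum_append, List.sum_singleton]
      rw [← add_assoc, ← refl_eq_add hβ h3, srefl_mult hβ hc ec, s_s]

lemma path_coroot {lam : D.V} (hd : D.IsPreDominant lam) {i : D.I}
    (e : D.coroot (D.simple i) lam = -1) (l : List D.V) (hl : D.IsWeightPath lam l) :
    D.coroot (D.simple i) (lam + l.sum) = -1 ∨ D.coroot (D.simple i) (lam + l.sum) = 0 ∨
      D.coroot (D.simple i) (lam + l.sum) = 1 := by
  have p1 := path_preDom l lam hd hl
  obtain ⟨l', hl', e'⟩ := path_reflect e l hl
  have p2 := (path_preDom l' lam hd hl').2 _ (simple_pos i)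
  rw [e', coroot_s_simple] at p2
  have p3 := p1.2 _ (simple_pos i)
  obtain ⟨n, hn⟩ := p1.1 _ (simple_pos i)
  rw [hn] at p2 p3 ⊢
  have a : -1 ≤ n := by exact_mod_cast p3
  have b : -1 ≤ -n := by exact_mod_cast p2
  have : n = -1 ∨ n = 0 ∨ n = 1 := by omega
  rcases this with rfl | rfl | rfl <;> simp


/-! ### the path functions and the Chevalley-type operator -/

section Main

variable {F : Type} [Field F] [Algebra ℚ F]

lemma pathTerm_nil (emb : D.V →ₗ[ℚ] F) : D.pathTerm emb [] = 1 := by simp [pathTerm]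

lemma pathTerm_append (emb : D.V →ₗ[ℚ] F) (l : List D.V) (β : D.V) :
    D.pathTerm emb (l ++ [β]) = D.pathTerm emb l * (emb (l.sum + β))⁻¹ := by
  unfold pathTerm
  rw [List.length_append, List.length_singleton, Finset.prod_range_succ]
  congr 1
  · apply Finset.prod_congr rfl
    intro j hj
    rw [Finset.mem_range] at hj
    rw [List.take_append_of_le_length (by omega)]
  · rw [List.take_of_length_le (by simp)]
    simp

/-- sum over the paths ending at `μ` -/
noncomputable def Fn (P : Finset (List D.V)) (emb : D.V →ₗ[ℚ] F) (lam mu : D.V) : F :=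
  ∑ l ∈ P, if lam + l.sum = mu then D.pathTerm emb l else 0

/-- the set of positive roots pairing to one with `μ` -/
noncomputable def Up (mu : D.V) : Finset D.V :=
  D.roots.filter fun β => D.IsPosRoot β ∧ D.coroot β mu = 1

lemma mem_Up {mu β : D.V} : β ∈ Up mu ↔ D.IsPosRoot β ∧ D.coroot β mu = 1 := by
  unfold Up
  rw [Finset.mem_filter]
  exact ⟨fun h => h.2, fun h => ⟨h.1.1, h⟩⟩

/-- the operator summing over incoming arrows -/
noncomputable def Mop (f : D.V → F) (mu : D.V) : F := ∑ β ∈ Up mu, f (mu - β)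

lemma path_sum_ne {lam : D.V} {l : List D.V} (hl : D.IsWeightPath lam l) (hne : l ≠ []) :
    l.sum ≠ 0 := by
  intro h0
  have := path_h l _ hl
  rw [h0, map_zero] at this
  have h1 : 0 < l.length := List.length_pos_iff.mpr hne
  have : (0 : ℚ) < l.length := by exact_mod_cast h1
  linarith

lemma Fn_eq {P : Finset (List D.V)} {lam : D.V} (hP : ∀ l, l ∈ P ↔ D.IsWeightPath lam l)
    {emb : D.V →ₗ[ℚ] F} (hemb : Function.Injective emb) (mu : D.V) :
    emb (mu - lam) * Fn P emb lam mu = Mop (Fn P emb lam) mu := by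
  unfold Mop Fn
  rw [← Finset.sum_product', Finset.mul_sum]
  symm
  apply Finset.sum_bij_ne_zero (fun x _ _ => x.2 ++ [x.1])
  · rintro ⟨β, l⟩ hx hne
    rw [Finset.mem_product, mem_Up] at hx
    obtain ⟨⟨hβ, h1⟩, hl⟩ := hx
    dsimp only at hne h1 hl hβ ⊢
    rw [hP] at hl ⊢
    have e : lam + l.sum = mu - β := by
      by_contra h; rw [if_neg h] at hne; exact hne rfl
    rw [path_append]
    refine ⟨hl, hβ, ?_⟩
    rw [e, map_sub, h1, D.coroot_self _ hβ.1]; norm_num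
  · rintro ⟨β, l⟩ _ _ ⟨β', l'⟩ _ _ e
    have := List.append_inj' e rfl
    simp at this
    simp [this.1, this.2]
  · intro l hl hne
    rw [hP] at hl
    have e : lam + l.sum = mu := by
      by_contra h; rw [if_neg h] at hne; exact hne (mul_zero _)
    rw [if_pos e] at hne
    rcases List.eq_nil_or_concat l with rfl | ⟨l', β, rfl⟩
    · exfalso
      apply hne
      rw [← e]; simp
    rw [List.concat_eq_append] at *
    have hl2 := hl
    rw [path_append] at hl
    have e' : lam + l'.sum = mu - β := by rw [← e]; simp; abel
    refine ⟨(β, l'), ?_, ?_, rfl⟩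
    · rw [Finset.mem_product, mem_Up, hP]
      refine ⟨⟨hl.2.1, ?_⟩, hl.1⟩
      have := hl.2.2
      rw [e', map_sub, D.coroot_self _ hl.2.1.1] at this
      linarith
    · dsimp only
      rw [if_pos e']
      rw [pathTerm_append] at hne
      intro h0
      rw [h0] at hne
      simp at hne
  · rintro ⟨β, l⟩ hx hne
    rw [Finset.mem_product, mem_Up, hP] at hx
    obtain ⟨⟨hβ, h1⟩, hl⟩ := hx
    dsimp only at hne h1 hl hβ ⊢
    have e : lam + l.sum = mu - β := by
      by_contra h; rw [if_neg h] at hne; exact hne rfl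
    have e2 : lam + (l ++ [β]).sum = mu := by
      simp only [List.sum_append, List.sum_singleton]
      rw [← add_assoc, e]; abel
    have e3 : mu - lam = l.sum + β := by
      rw [← e2]; simp only [List.sum_append, List.sum_singleton]; abel
    rw [if_pos e, if_pos e2, pathTerm_append, e3]
    have hz : emb (l.sum + β) ≠ 0 := by
      rw [Ne, map_eq_zero_iff _ hemb]
      have hp : D.IsWeightPath lam (l ++ [β]) := by
        rw [path_append]
        refine ⟨hl, hβ, ?_⟩
        rw [e, map_sub, h1, D.coroot_self _ hβ.1]; norm_num
      have := path_sum_ne hp (by simp)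
      simpa using this
    field_simp

lemma Fn_ne_zero {P : Finset (List D.V)} {lam mu : D.V} {emb : D.V →ₗ[ℚ] F}
    (hne : Fn P emb lam mu ≠ 0) : ∃ l ∈ P, lam + l.sum = mu := by
  obtain ⟨l, hl, h⟩ := Finset.exists_ne_zero_of_sum_ne_zero hne
  refine ⟨l, hl, ?_⟩
  by_contra h'
  rw [if_neg h'] at h
  exact h rfl

lemma Fn_finite (P : Finset (List D.V)) (lam : D.V) (emb : D.V →ₗ[ℚ] F) :
    (Function.support (Fn P emb lam)).Finite := by
  apply (P.image fun l => lam + l.sum).finite_toSet.subset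
  intro mu hmu
  obtain ⟨l, hl, e⟩ := Fn_ne_zero hmu
  rw [Finset.mem_coe, Finset.mem_image]
  exact ⟨l, hl, e⟩

lemma Fn_total (P : Finset (List D.V)) (lam : D.V) (emb : D.V →ₗ[ℚ] F) :
    ∑ᶠ mu, Fn P emb lam mu = ∑ l ∈ P, D.pathTerm emb l := by
  rw [finsum_eq_sum_of_support_subset (s := P.image fun l => lam + l.sum)]
  · unfold Fn
    rw [Finset.sum_comm]
    apply Finset.sum_congr rfl
    intro l hl
    rw [Finset.sum_ite_eq, if_pos (Finset.mem_image_of_mem (fun l => lam + l.sum) hl)]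
  · intro mu hmu
    obtain ⟨l, hl, e⟩ := Fn_ne_zero hmu
    rw [Finset.mem_coe, Finset.mem_image]
    exact ⟨l, hl, e⟩

lemma Fn_base {P : Finset (List D.V)} {lam : D.V} (hP : ∀ l, l ∈ P ↔ D.IsWeightPath lam l)
    (emb : D.V →ₗ[ℚ] F) : Fn P emb lam lam = 1 := by
  unfold Fn
  rw [Finset.sum_eq_single_of_mem [] ((hP _).mpr trivial)]
  · simp [pathTerm_nil]
  · intro l hl hne
    rw [if_neg]
    intro e
    exact path_sum_ne ((hP _).mp hl) hne (by simpa using e)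

lemma Fn_simple {P : Finset (List D.V)} {lam : D.V} (hP : ∀ l, l ∈ P ↔ D.IsWeightPath lam l)
    (emb : D.V →ₗ[ℚ] F) {i : D.I} (e : D.coroot (D.simple i) lam = -1) :
    Fn P emb lam (lam + D.simple i) = (emb (D.simple i))⁻¹ := by
  unfold Fn
  rw [Finset.sum_eq_single_of_mem [D.simple i] ((hP _).mpr ⟨simple_pos i, e, trivial⟩)]
  · simp [pathTerm]
  · intro l hl hne
    rw [if_neg]
    intro e'
    have e1 : l.sum = D.simple i := by simpa using e'
    have := path_h l _ ((hP _).mp hl)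
    rw [e1, h_simple] at this
    have h1 : l.length ≤ 1 := by exact_mod_cast this
    match l, h1 with
    | [], _ => exact root_ne_zero (D.simple_mem i) (by simpa using e1.symm)
    | [x], _ => exact hne (by simpa using e1)

/-- uniqueness of eigenvectors -/
lemma eigen_unique {i : D.I} {lam' : D.V} {emb : D.V →ₗ[ℚ] F} (hemb : Function.Injective emb)
    (K : D.V → F) (hK : (Function.support K).Finite)
    (hE : ∀ mu, emb (D.act (D.s i) (mu - lam')) * K mu = Mop K mu) (h0 : K lam' = 0) :
    ∀ mu, K mu = 0 := by
  by_contra hne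
  push Not at hne
  obtain ⟨mu0, hmu0⟩ := hne
  obtain ⟨mu, hmu, hmin⟩ := Set.exists_min_image _ (h D) hK ⟨mu0, hmu0⟩
  have h1 : Mop K mu = 0 := by
    apply Finset.sum_eq_zero
    intro β hβ
    by_contra h2
    have h3 := hmin (mu - β) h2
    have h4 := pos_h (mem_Up.mp hβ).1
    rw [map_sub] at h3
    linarith
  have h2 := hE mu
  rw [h1] at h2
  rcases mul_eq_zero.mp h2 with h3 | h3
  · rw [map_eq_zero_iff _ hemb, LinearEquiv.map_eq_zero_iff, sub_eq_zero] at h3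
    rw [h3] at hmu
    exact hmu h0
  · exact hmu h3

/-- the part of `Up` made of multiples of the simple root -/
lemma Mop_comm {i : D.I} (f : D.V → F) (mu : D.V)
    (hf : f mu ≠ 0 → D.coroot (D.simple i) mu = -1 ∨ D.coroot (D.simple i) mu = 0 ∨
      D.coroot (D.simple i) mu = 1) :
    Mop f (D.act (D.s i) mu) =
      Mop (fun x => f (D.act (D.s i) x)) mu
        - algebraMap ℚ F (D.coroot (D.simple i) mu) * f mu := by
  unfold Mop
  have key : ∀ nu : D.V, ∀ β ∈ Up nu, ¬ D.IsPosRoot (D.act (D.s i) β) →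
      (∃ c : ℕ, 1 ≤ c ∧ D.coroot (D.simple i) nu = c ∧ β = (c : ℚ) • D.simple i) := by
    intro nu β hβ hn
    rw [mem_Up] at hβ
    rcases s_pos_or i hβ.1 with hp | ⟨c, hc, ec⟩
    · exact absurd hp hn
    · have := coroot_mult hβ.1 hc ec nu
      rw [hβ.2, mul_one] at this
      exact ⟨c, hc, this.symm, ec⟩
  rw [← Finset.sum_filter_add_sum_filter_not (Up (D.act (D.s i) mu))
      (fun β => D.IsPosRoot (D.act (D.s i) β)),
    ← Finset.sum_filter_add_sum_filter_not (Up mu) (fun β => D.IsPosRoot (D.act (D.s i) β))]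
  have e1 : ∑ β ∈ (Up (D.act (D.s i) mu)).filter (fun β => D.IsPosRoot (D.act (D.s i) β)),
        f (D.act (D.s i) mu - β) =
      ∑ β ∈ (Up mu).filter (fun β => D.IsPosRoot (D.act (D.s i) β)),
        f (D.act (D.s i) (mu - β)) := by
    apply Finset.sum_nbij' (fun β => D.act (D.s i) β) (fun β => D.act (D.s i) β)
    · intro β hβ
      rw [Finset.mem_filter, mem_Up] at hβ
      obtain ⟨⟨h1, h2⟩, h3⟩ := hβ
      rw [Finset.mem_filter, mem_Up, s_s]
      exact ⟨⟨h3, by rw [← coroot_s h1.1, h2]⟩, h1⟩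
    · intro β hβ
      rw [Finset.mem_filter, mem_Up] at hβ
      obtain ⟨⟨h1, h2⟩, h3⟩ := hβ
      rw [Finset.mem_filter, mem_Up, s_s]
      exact ⟨⟨h3, by rw [D.coroot_equivariant _ _ h1.1, h2]⟩, h1⟩
    · intro β _; exact s_s i β
    · intro β _; exact s_s i β
    · intro β _
      rw [map_sub, s_s]
  have e2 : ∀ β ∈ (Up (D.act (D.s i) mu)).filter (fun β => ¬ D.IsPosRoot (D.act (D.s i) β)),
      f (D.act (D.s i) mu - β) = f mu := by
    intro β hβ
    rw [Finset.mem_filter] at hβ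
    obtain ⟨c, hc, h1, h2⟩ := key _ β hβ.1 hβ.2
    rw [coroot_s_simple] at h1
    rw [s_apply, h2, ← h1]
    congr 1
    module
  have e3 : ∀ β ∈ (Up mu).filter (fun β => ¬ D.IsPosRoot (D.act (D.s i) β)),
      f (D.act (D.s i) (mu - β)) = f mu := by
    intro β hβ
    rw [Finset.mem_filter] at hβ
    obtain ⟨c, hc, h1, h2⟩ := key _ β hβ.1 hβ.2
    rw [map_sub, s_apply i mu, h2, map_smul, s_simple, ← h1]
    congr 1
    module
  rw [e1, Finset.sum_congr rfl e2, Finset.sum_congr rfl e3, Finset.sum_const, Finset.sum_const]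
  by_cases h0 : f mu = 0
  · simp [h0]
  have hcard : ∀ nu : D.V, D.coroot (D.simple i) nu ≤ 0 →
      ((Up nu).filter (fun β => ¬ D.IsPosRoot (D.act (D.s i) β))).card = 0 := by
    intro nu hnu
    rw [Finset.card_eq_zero, Finset.filter_eq_empty_iff]
    intro β hβ hn
    obtain ⟨c, hc, h1, -⟩ := key _ β hβ hn
    have : (1 : ℚ) ≤ c := by exact_mod_cast hc
    linarith
  have hcard1 : ∀ nu : D.V, D.coroot (D.simple i) nu = 1 →
      ((Up nu).filter (fun β => ¬ D.IsPosRoot (D.act (D.s i) β))).card = 1 := by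
    intro nu hnu
    rw [Finset.card_eq_one]
    refine ⟨D.simple i, ?_⟩
    ext β
    rw [Finset.mem_filter, Finset.mem_singleton]
    constructor
    · rintro ⟨hβ, hn⟩
      obtain ⟨c, hc, h1, h2⟩ := key _ β hβ hn
      rw [h2, ← h1, hnu, one_smul]
    · rintro rfl
      refine ⟨mem_Up.mpr ⟨simple_pos i, hnu⟩, ?_⟩
      rw [s_simple]
      exact not_pos_neg (simple_pos i)
  have hs := coroot_s_simple i mu
  rcases hf h0 with hm | hm | hm
  · rw [hcard mu (by rw [hm]; norm_num), hcard1 (D.act (D.s i) mu) (by rw [hs, hm]; norm_num), hm]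
    simp
  · rw [hcard mu (by rw [hm]), hcard (D.act (D.s i) mu) (by rw [hs, hm]; norm_num), hm]
    simp
  · rw [hcard1 mu hm, hcard (D.act (D.s i) mu) (by rw [hs, hm]; norm_num), hm]
    simp

/-- twisting an embedding by a simple reflection -/
noncomputable def twist (emb : D.V →ₗ[ℚ] F) (i : D.I) : D.V →ₗ[ℚ] F :=
  emb.comp (D.act (D.s i)).toLinearMap

lemma twist_apply (emb : D.V →ₗ[ℚ] F) (i : D.I) (v : D.V) :
    twist emb i v = emb (D.act (D.s i) v) := rfl

lemma twist_inj {emb : D.V →ₗ[ℚ] F} (hemb : Function.Injective emb) (i : D.I) :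
    Function.Injective (twist emb i) := hemb.comp (D.act (D.s i)).injective

lemma main_rec {P P' : Finset (List D.V)} {lam' : D.V} {i : D.I}
    (hd : D.IsPreDominant lam') (e : D.coroot (D.simple i) lam' = 1)
    (hP : ∀ l, l ∈ P ↔ D.IsWeightPath (D.act (D.s i) lam') l)
    (hP' : ∀ l, l ∈ P' ↔ D.IsWeightPath lam' l)
    {emb : D.V →ₗ[ℚ] F} (hemb : Function.Injective emb) (h1 : emb (D.simple i) ≠ 1) :
    ∑ l ∈ P, D.pathTerm emb l =
      (1 + (emb (D.simple i))⁻¹) * ∑ l ∈ P', D.pathTerm (twist emb i) l := by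
  set lam := D.act (D.s i) lam' with hlam
  set a := emb (D.simple i) with ha
  have ha0 : a ≠ 0 := by
    rw [ha, Ne, map_eq_zero_iff _ hemb]; exact root_ne_zero (D.simple_mem i)
  have hdl : D.IsPreDominant lam := preDom_back hd e
  have el : D.coroot (D.simple i) lam = -1 := by rw [hlam, coroot_s_simple, e]
  have elam : D.act (D.s i) lam = lam' := s_s i lam'
  have elam2 : lam + D.simple i = lam' := by
    rw [hlam, s_apply, e]; module
  let f := Fn P emb lam
  let g := Fn P' (twist emb i) lam'
  let c : F := 1 - a⁻¹ * a⁻¹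
  have hsf : (Function.support fun x => f (D.act (D.s i) x)).Finite := by
    have : (Function.support fun x => f (D.act (D.s i) x)) =
        (D.act (D.s i)) ⁻¹' (Function.support f) := rfl
    rw [this]
    exact (Fn_finite P lam emb).preimage (D.act (D.s i)).injective.injOn
  have hff : (Function.support f).Finite := Fn_finite P lam emb
  have hgf : (Function.support g).Finite := Fn_finite P' lam' _
  have hK : ∀ mu, f (D.act (D.s i) mu) - a⁻¹ * f mu - c * g mu = 0 := by
    apply eigen_unique (i := i) (lam' := lam') hemb
      (fun mu => f (D.act (D.s i) mu) - a⁻¹ * f mu - c * g mu)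
    · apply ((hsf.union hff).union hgf).subset
      intro mu hmu
      by_contra hn
      simp only [Set.mem_union, Function.mem_support, not_or, not_not] at hn
      apply hmu
      simp [hn.1.1, hn.1.2, hn.2]
    · intro mu
      have m1 := Mop_comm (i := i) f mu (by
        intro hne
        obtain ⟨l, hl, e'⟩ := Fn_ne_zero hne
        rw [← e']
        exact path_coroot hdl el l ((hP l).mp hl))
      have m2 := Fn_eq hP hemb mu
      have m3 := Fn_eq hP hemb (D.act (D.s i) mu)
      have m4 := Fn_eq hP' (twist_inj hemb i) mu
      have m5 : Mop (fun mu => f (D.act (D.s i) mu) - a⁻¹ * f mu - c * g mu) mu =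
          Mop (fun x => f (D.act (D.s i) x)) mu - a⁻¹ * Mop f mu - c * Mop g mu := by
        simp only [Mop, Finset.sum_sub_distrib, Finset.mul_sum]
      have m6 : emb (D.act (D.s i) mu) =
          emb mu - algebraMap ℚ F (D.coroot (D.simple i) mu) * a := by
        rw [s_apply, map_sub, map_smul, Algebra.smul_def]
      rw [m5]
      change emb (mu - lam) * f mu = Mop f mu at m2
      change emb (D.act (D.s i) mu - lam) * f (D.act (D.s i) mu) = Mop f (D.act (D.s i) mu) at m3
      change emb (D.act (D.s i) (mu - lam')) * g mu = Mop g mu at m4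
      rw [← m2, ← m4]
      have m7 : Mop (fun x => f (D.act (D.s i) x)) mu = Mop f (D.act (D.s i) mu) +
          algebraMap ℚ F (D.coroot (D.simple i) mu) * f mu := by rw [m1]; ring
      rw [m7, ← m3, map_sub, map_sub, map_sub, ← hlam, m6]
      field_simp
      ring
    · change f (D.act (D.s i) lam') - a⁻¹ * f lam' - c * g lam' = 0
      have f1 : f lam = 1 := Fn_base hP emb
      have f2 : f lam' = a⁻¹ := by rw [← elam2]; exact Fn_simple hP emb el
      have f3 : g lam' = 1 := Fn_base hP' _
      rw [← hlam, f1, f2, f3]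
      ring
  have hs1 : ∑ᶠ mu, f (D.act (D.s i) mu) = ∑ᶠ mu, f mu :=
    finsum_comp_equiv (D.act (D.s i)).toEquiv
  have hs2 : ∑ᶠ mu, f (D.act (D.s i) mu) = a⁻¹ * ∑ᶠ mu, f mu + c * ∑ᶠ mu, g mu := by
    rw [mul_finsum' _ _ hff, mul_finsum' _ _ hgf, ← finsum_add_distrib]
    · apply finsum_congr
      intro mu
      linear_combination hK mu
    · exact hff.subset fun x hx hx' => hx (by simp [hx'])
    · exact hgf.subset fun x hx hx' => hx (by simp [hx'])
  have t1 : ∑ᶠ mu, f mu = _ := Fn_total P lam emb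
  have t2 : ∑ᶠ mu, g mu = _ := Fn_total P' lam' (twist emb i)
  rw [hs1, t1, t2] at hs2
  have h3 : (1 - a⁻¹) ≠ 0 := by
    intro h; apply h1
    have : a⁻¹ = 1 := by linear_combination -h
    simpa using this
  apply mul_left_cancel₀ h3
  linear_combination hs2

lemma main_word {pi : D.V} (hpi : D.IsDominant pi) (l : List D.I) : MinWord pi l →
    ∀ (P : Finset (List D.V)) (_ : ∀ p, p ∈ P ↔ D.IsWeightPath (D.act (D.wordProd l) pi) p)
      (emb : D.V →ₗ[ℚ] F) (_ : Function.Injective emb) (_ : ∀ β ∈ D.roots, emb β ≠ 1),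
    ∑ p ∈ P, D.pathTerm emb p =
      ∏ β ∈ D.diagram (D.act (D.wordProd l) pi), (1 + (emb β)⁻¹) := by
  induction l with
  | nil =>
    intro _ P hP emb _ _
    have e : D.act (D.wordProd []) pi = pi := by simp [wordProd]
    rw [e] at hP ⊢
    rw [diagram_dom hpi, Finset.prod_empty]
    have : P = {[]} := by
      ext p
      rw [hP, Finset.mem_singleton]
      constructor
      · intro hp
        match p, hp with
        | [], _ => rfl
        | β :: _, hp =>
          exfalso
          have := dom_nonneg hpi hp.1
          rw [hp.2.1] at this
          norm_num at this
      · rintro rfl; trivial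
    rw [this, Finset.sum_singleton, pathTerm_nil]
  | cons i l ih =>
    intro hl P hP emb hemb h1
    rw [wordProd_cons, act_mul] at hP ⊢
    have hfin := path_finite hpi (D.wordProd l)
    have hP' : ∀ p, p ∈ hfin.toFinset ↔ D.IsWeightPath (D.act (D.wordProd l) pi) p := by
      intro p; rw [Set.Finite.mem_toFinset]; rfl
    rw [main_rec (minWord_preDom hpi l hl.2) hl.1 hP hP' hemb (h1 _ (D.simple_mem i)),
      ih hl.2 _ hP' (twist emb i) (twist_inj hemb i)
        (fun β hβ => h1 _ (D.roots_invariant _ _ hβ)),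
      diagram_back hl.1, Finset.prod_insert simple_not_mem,
      Finset.prod_image (D.act (D.s i)).injective.injOn]
    rfl

/-- rescaling an embedding -/
noncomputable def scale (emb : D.V →ₗ[ℚ] F) (t : F) : D.V →ₗ[ℚ] F :=
  (LinearMap.mulLeft ℚ t⁻¹).comp emb

lemma scale_apply (emb : D.V →ₗ[ℚ] F) (t : F) (v : D.V) : scale emb t v = t⁻¹ * emb v := rfl

lemma pathTerm_scale (emb : D.V →ₗ[ℚ] F) (t : F) (l : List D.V) :
    D.pathTerm (scale emb t) l = t ^ l.length * D.pathTerm emb l := by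
  unfold pathTerm
  rw [← Finset.card_range l.length, ← Finset.prod_const, Finset.card_range,
    ← Finset.prod_mul_distrib]
  apply Finset.prod_congr rfl
  intro j _
  rw [scale_apply, mul_inv, inv_inv]

open Polynomial in
lemma main_poly {pi : D.V} (hpi : D.IsDominant pi) (l : List D.I) (hl : MinWord pi l)
    (P : Finset (List D.V)) (hP : ∀ p, p ∈ P ↔ D.IsWeightPath (D.act (D.wordProd l) pi) p)
    (emb : D.V →ₗ[ℚ] F) (hemb : Function.Injective emb) :
    ∑ p ∈ P, C (D.pathTerm emb p) * X ^ p.length =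
      ∏ β ∈ D.diagram (D.act (D.wordProd l) pi), (1 + C (emb β)⁻¹ * X) := by
  have hinj : Function.Injective (algebraMap ℚ F) := (algebraMap ℚ F).injective
  apply Polynomial.eq_of_infinite_eval_eq
  have hinf : (Set.range (algebraMap ℚ F) \
      (↑(insert (0 : F) (D.roots.image emb)) : Set F)).Infinite :=
    (Set.infinite_range_of_injective hinj).sdiff (Finset.finite_toSet _)
  apply hinf.mono
  rintro x ⟨⟨t, rfl⟩, hx⟩
  rw [Finset.mem_coe, Finset.mem_insert, not_or] at hx
  have key := main_word hpi l hl P hP (scale emb (algebraMap ℚ F t)) (by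
      intro x y hxy
      simp only [scale_apply] at hxy
      exact hemb (mul_left_cancel₀ (inv_ne_zero hx.1) hxy)) (by
      intro β hβ h1
      apply hx.2
      rw [Finset.mem_image]
      refine ⟨β, hβ, ?_⟩
      rw [scale_apply, inv_mul_eq_one₀ hx.1] at h1
      exact h1.symm)
  change eval _ _ = eval _ _
  rw [eval_finsetSum, eval_prod]
  simp only [eval_mul, eval_C, eval_pow, eval_X, eval_add, eval_one]
  simp only [pathTerm_scale] at key
  calc _ = _ := Finset.sum_congr rfl fun p _ => mul_comm _ _
    _ = _ := key
    _ = _ := Finset.prod_congr rfl fun β _ => by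
      rw [scale_apply, mul_inv, inv_inv, mul_comm]

end Main

end NakadaAux

/-- **Nakada's formula in Weyl-group form.** For a dominant integral weight `π`
and a `π`-minuscule `w`, the sum over all directed paths
`x_r →β_r ⋯ → x_1 →β₁ x_0 = w` in `W^π` of `1/β₁ ⋯ 1/(β₁+⋯+β_r)` equals
`∏_{β ∈ S(w)} (1 + 1/β)`; moreover `|S(w)| = ℓ(w)` and the sum restricted to
paths of maximal length `d = |S(w)| = ℓ(w)` equals `∏_{β ∈ S(w)} 1/β`. -/
theorem nakada_weyl_group_form
    (D : WeylSetting) (pi : D.V) (hpi : D.IsDominant pi)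
    (w : D.W) (hw : D.IsMinuscule pi w)
    (F : Type) [Field F] [Algebra ℚ F] (emb : D.V →ₗ[ℚ] F)
    (hemb : Function.Injective emb) :
    ((∑ᶠ l : List D.V, if D.ArrowPath (D.stab pi) w l then D.pathTerm emb l else 0) =
      ∏ β ∈ D.Sset w, (1 + (emb β)⁻¹)) ∧
    (D.Sset w).card = D.length w ∧
    ((∑ᶠ l : List D.V,
        if D.ArrowPath (D.stab pi) w l ∧ l.length = D.length w then
          D.pathTerm emb l else 0) =
      ∏ β ∈ D.Sset w, (emb β)⁻¹) := by
  classical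
  obtain ⟨wd, ⟨hwd, hlen⟩, hmin⟩ := hw
  subst hwd
  have hm := NakadaAux.minWord_of wd hmin
  have hg := NakadaAux.minWord_good wd hm
  have hd := NakadaAux.minWord_preDom hpi wd hm
  have hS := NakadaAux.Sset_eq hpi hg hd
  have hfin := NakadaAux.path_finite hpi (D.wordProd wd)
  have hP : ∀ p, p ∈ hfin.toFinset ↔ D.IsWeightPath (D.act (D.wordProd wd) pi) p := by
    intro p; rw [Set.Finite.mem_toFinset]; rfl
  have hA : ∀ p, D.ArrowPath (D.stab pi) (D.wordProd wd) p ↔ p ∈ hfin.toFinset := by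
    intro p; rw [hP]; exact NakadaAux.arrowPath_iff hpi p _ hg hd
  have hcard := NakadaAux.diagram_card hpi wd hm
  have hpoly := NakadaAux.main_poly hpi wd hm _ hP emb hemb
  rw [hS]
  refine ⟨?_, hcard.trans hlen, ?_⟩
  · have := congrArg (Polynomial.eval 1) hpoly
    rw [Polynomial.eval_finsetSum, Polynomial.eval_prod] at this
    simp only [Polynomial.eval_mul, Polynomial.eval_C, Polynomial.eval_pow, Polynomial.eval_X,
      Polynomial.eval_add, Polynomial.eval_one, one_pow, mul_one] at this
    rw [← this, finsum_eq_sum_of_support_subset (s := hfin.toFinset)]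
    · exact Finset.sum_congr rfl fun p hp => if_pos ((hA p).mpr hp)
    · intro p hp
      by_contra hn
      exact hp (if_neg fun h => hn ((hA p).mp h))
  · have := congrArg (fun q => Polynomial.coeff q wd.length) hpoly
    simp only [Polynomial.finsetSum_coeff, Polynomial.coeff_C_mul, Polynomial.coeff_X_pow] at this
    have h2 := Polynomial.coeff_prod_of_natDegree_le
      (s := D.diagram (D.act (D.wordProd wd) pi))
      (fun β => (1 + Polynomial.C (emb β)⁻¹ * Polynomial.X : Polynomial F)) 1 (by
        intro β _
        compute_degree)
    rw [hcard, mul_one] at h2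
    rw [h2] at this
    simp only [Polynomial.coeff_add, Polynomial.coeff_C_mul, Polynomial.coeff_X_one,
      Polynomial.coeff_one, mul_one, one_ne_zero, if_false, zero_add] at this
    rw [← this, finsum_eq_sum_of_support_subset (s := hfin.toFinset)]
    · apply Finset.sum_congr rfl
      intro p hp
      by_cases hl : p.length = wd.length
      · rw [if_pos ⟨(hA p).mpr hp, hl.trans hlen⟩, if_pos hl.symm, mul_one]
      · rw [if_neg fun h => hl (h.2.trans hlen.symm), if_neg fun h => hl h.symm, mul_zero]
    · intro p hp
      by_contra hn
      exact hp (if_neg fun h => hn ((hA p).mp h.1))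
end
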